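/- Let v ∈ W^{1,2}_loc(B) be a weak solution of div(A∇v) = 0 in B = B(0,1) ⊆ ℝ^k, with v not identically zero. Then there exist constants ρ₀ > 0, C₁ > 0 and C₂ > 0, depending only on k, the Lipschitz constant of the entries of A and the ellipticity constant of A, such that for every x ∈ B(0,1/2) and every r with 0 < 4r < ρ₀, one has C₁⁻¹·N_v(x,r) − C₂ ≤ 𝒩_v(x,r) ≤ C₁·N_v(x,2r) + C₂, where N_v is the frequency function and 𝒩_v is the doubling index. -/

import Mathlib

open MeasureTheory Metric Set
open scoped ENNReal NNReal Topology ContDiff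

noncomputable section
attribute [local instance] Classical.propDecidable

abbrev Euc (n : ℕ) := EuclideanSpace ℝ (Fin n)

/-- The gradient vector of `v` at `x`, as a tuple of partial derivatives. -/
def gradVec {k : ℕ} (v : Euc k → ℝ) (x : Euc k) : Fin k → ℝ :=
  fun i => fderiv ℝ v x (EuclideanSpace.single i 1)

/-- The bilinear form `⟨A ξ, ζ⟩ = ∑ i j, A i j * ξ j * ζ i` associated with a matrix. -/
def aForm {k : ℕ} (A : Matrix (Fin k) (Fin k) ℝ) (ξ ζ : Fin k → ℝ) : ℝ :=
  ∑ i, ∑ j, A i j * ξ j * ζ i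

/-- `A` is uniformly elliptic with constant `Λ` on `U`:
`Λ⁻¹|ξ|² ≤ ⟨A(x)ξ, ξ⟩ ≤ Λ|ξ|²` for all `x ∈ U`, `ξ ∈ ℝᵏ`. -/
def UnifElliptic {k : ℕ} (A : Euc k → Matrix (Fin k) (Fin k) ℝ) (Λ : ℝ) (U : Set (Euc k)) :
    Prop :=
  ∀ x ∈ U, ∀ ξ : Fin k → ℝ,
    Λ⁻¹ * (∑ i, ξ i ^ 2) ≤ aForm (A x) ξ ξ ∧ aForm (A x) ξ ξ ≤ Λ * (∑ i, ξ i ^ 2)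

/-- The entries of `A` are Lipschitz with constant `L` on `U`. -/
def LipEntries {k : ℕ} (A : Euc k → Matrix (Fin k) (Fin k) ℝ) (L : ℝ≥0) (U : Set (Euc k)) :
    Prop :=
  ∀ i j, LipschitzOnWith L (fun x => A x i j) U

/-- `v` is a weak solution of `div(A ∇v) = 0` in `U`:
`∫_U ⟨A(x)∇v(x), ∇ψ(x)⟩ dx = 0` for every test function `ψ ∈ C_c^∞(U)`. -/
def IsWeakSol {k : ℕ} (A : Euc k → Matrix (Fin k) (Fin k) ℝ) (v : Euc k → ℝ)
    (U : Set (Euc k)) : Prop :=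
  ∀ ψ : Euc k → ℝ, ContDiff ℝ ∞ ψ → HasCompactSupport ψ → tsupport ψ ⊆ U →
    ∫ x in U, aForm (A x) (gradVec v x) (gradVec ψ x) = 0

/-- `α(x) = ⟨A(x)x, x⟩/|x|²`, with `α(0) = 1`. -/
def alphaFn {k : ℕ} (A : Euc k → Matrix (Fin k) (Fin k) ℝ) (x : Euc k) : ℝ :=
  if x = 0 then 1 else aForm (A x) (fun i => x i) (fun i => x i) / ‖x‖ ^ 2

/-- `H_v(x,r) = ∫_{B(x,r)} α v²`. -/
def Hfun {k : ℕ} (A : Euc k → Matrix (Fin k) (Fin k) ℝ) (v : Euc k → ℝ) (x : Euc k)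
    (r : ℝ) : ℝ :=
  ∫ z in ball x r, alphaFn A z * v z ^ 2

/-- The frequency function `N_v(x,r) = r ∂_r H_v(x,r) / H_v(x,r)`. -/
def freqN {k : ℕ} (A : Euc k → Matrix (Fin k) (Fin k) ℝ) (v : Euc k → ℝ) (x : Euc k)
    (r : ℝ) : ℝ :=
  r * deriv (Hfun A v x) r / Hfun A v x r

/-- The doubling index `𝒩_v(x,r) = log (H_v(x,2r) / H_v(x,r))`. -/
def doubN {k : ℕ} (A : Euc k → Matrix (Fin k) (Fin k) ℝ) (v : Euc k → ℝ) (x : Euc k)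
    (r : ℝ) : ℝ :=
  Real.log (Hfun A v x (2 * r) / Hfun A v x r)


section Core
open Filter
variable {E : Type*} [NormedAddCommGroup E] [InnerProductSpace ℝ E] [FiniteDimensional ℝ E]
  [MeasurableSpace E] [BorelSpace E]
variable {F : Type*} [NormedAddCommGroup F] [NormedSpace ℝ F] [CompleteSpace F]

open scoped Convolution in
lemma moll_aux (φ : ContDiffBump (0 : E)) {f : E → F} (hf : Continuous f) (x y : E) {c : ℝ} 
    (u : E → F) (hu : Continuous u) 
    (h : ∀ t ∈ ball (0 : E) φ.rOut, ‖(f (x - t) - u x) - (f (y - t) - u y)‖ ≤ c) :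
    ‖((φ.normed volume ⋆[ContinuousLinearMap.lsmul ℝ ℝ, volume] f : E → F) x - u x) -
      ((φ.normed volume ⋆[ContinuousLinearMap.lsmul ℝ ℝ, volume] f : E → F) y - u y)‖ ≤ c := by
  have hint : ∀ z, Integrable (fun t => φ.normed volume t • (f (z - t) - u z)) := by
    intro z
    refine Continuous.integrable_of_hasCompactSupport ?_ ?_
    · exact φ.continuous_normed.smul ((hf.comp (by fun_prop)).sub continuous_const)
    · exact φ.hasCompactSupport_normed.smul_right
  have e : ∀ z, (φ.normed volume ⋆[ContinuousLinearMap.lsmul ℝ ℝ, volume] f : E → F) z - u z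
      = ∫ t, φ.normed volume t • (f (z - t) - u z) := by
    intro z
    have h1 : ∫ t, φ.normed volume t • u z = u z := by
      rw [integral_smul_const, φ.integral_normed, one_smul]
    have i1 : Integrable (fun t => φ.normed volume t • u z) := φ.integrable_normed.smul_const _
    have i2 : Integrable (fun t => φ.normed volume t • f (z - t)) := by
      refine ((hint z).add i1).congr ?_
      filter_upwards with t
      simp [smul_sub]
    simp only [smul_sub]
    rw [integral_sub i2 i1, h1]
    simp [convolution_def]
  rw [e, e, ← integral_sub (hint x) (hint y)]
  have hc : c = ∫ t, φ.normed (volume : Measure E) t * c := by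
    rw [integral_mul_const, φ.integral_normed, one_mul]
  rw [hc]
  refine norm_integral_le_of_norm_le (φ.integrable_normed.mul_const _) ?_
  filter_upwards with t
  rw [← smul_sub, norm_smul, Real.norm_of_nonneg (φ.nonneg_normed t)]
  by_cases ht : t ∈ ball (0 : E) φ.rOut
  · exact mul_le_mul_of_nonneg_left (h t ht) (φ.nonneg_normed t)
  · have : φ.normed (volume : Measure E) t = 0 := by
      rw [← Function.notMem_support, φ.support_normed_eq]; exact ht
    simp [this]

open scoped Convolution in
lemma moll_lip {f : E → F} {L : ℝ} (hL : 0 ≤ L) (hf : ∀ y z, ‖f y - f z‖ ≤ L * ‖y - z‖)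
    {δ : ℝ} (hδ : 0 < δ) :
    ∃ g : E → F, ContDiff ℝ 1 g ∧ (∀ y, ‖g y - f y‖ ≤ δ) ∧ ∀ y, ‖fderiv ℝ g y‖ ≤ L := by
  have hfc : Continuous f := by
    have : LipschitzWith ⟨L, hL⟩ f := LipschitzWith.of_dist_le_mul (by
      intro x y; rw [dist_eq_norm, dist_eq_norm]; exact hf x y)
    exact this.continuous
  set ε := δ / (L + 1) with hε
  have hε0 : 0 < ε := by positivity
  set φ : ContDiffBump (0 : E) := ⟨ε / 2, ε, half_pos hε0, half_lt_self hε0⟩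
  refine ⟨(φ.normed volume ⋆[ContinuousLinearMap.lsmul ℝ ℝ, volume] f : E → F), ?_, ?_, ?_⟩
  · exact φ.hasCompactSupport_normed.contDiff_convolution_left _ φ.contDiff_normed
      hfc.locallyIntegrable
  · intro y
    rw [← dist_eq_norm]
    refine φ.dist_normed_convolution_le hfc.aestronglyMeasurable ?_
    intro x hx
    rw [dist_eq_norm]
    refine (hf x y).trans ?_
    have : ‖x - y‖ < ε := by simpa [dist_eq_norm, φ] using hx
    have h2 : L * ε ≤ δ := by
      rw [hε, mul_div_assoc', div_le_iff₀ (by positivity)]; nlinarith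
    nlinarith
  · intro y
    refine norm_fderiv_le_of_lip' ℝ hL (Eventually.of_forall fun x => ?_)
    have := moll_aux φ hfc x y (c := L * ‖x - y‖) (fun _ => 0) continuous_const (by
      intro t _
      simp only [sub_zero]
      refine (hf _ _).trans ?_
      simp)
    simpa using this

open scoped Convolution in
lemma moll_C1 {ψ : E → ℝ} (hψ : ContDiff ℝ 1 ψ) (hc : HasCompactSupport ψ) {ε δ : ℝ} (hε : 0 < ε)
    (hδ : 0 < δ) :
    ∃ g : E → ℝ, ContDiff ℝ ∞ g ∧ tsupport g ⊆ cthickening δ (tsupport ψ) ∧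
      ∀ y, ‖fderiv ℝ g y - fderiv ℝ ψ y‖ ≤ ε := by
  have hcont : Continuous (fderiv ℝ ψ) := hψ.continuous_fderiv (by norm_num)
  have huc := hc.fderiv ℝ |>.uniformContinuous_of_continuous hcont
  rcases Metric.uniformContinuous_iff.mp huc ε hε with ⟨η, hη, hu⟩
  set ρ := min η δ with hρ
  have hρ0 : 0 < ρ := lt_min hη hδ
  set φ : ContDiffBump (0 : E) := ⟨ρ / 2, ρ, half_pos hρ0, half_lt_self hρ0⟩
  have hsm : ContDiff ℝ ∞ (φ.normed volume ⋆[ContinuousLinearMap.lsmul ℝ ℝ, volume] ψ : E → ℝ) :=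
    φ.hasCompactSupport_normed.contDiff_convolution_left _ φ.contDiff_normed
      hψ.continuous.locallyIntegrable
  refine ⟨_, hsm, ?_, ?_⟩
  · refine closure_minimal ?_ isClosed_cthickening
    refine (support_convolution_subset _).trans ?_
    rintro _ ⟨a, ha, b, hb, rfl⟩
    rw [φ.support_normed_eq] at ha
    refine mem_cthickening_of_dist_le _ b _ _ (subset_tsupport _ hb) ?_
    have : ‖a‖ < ρ := by simpa [φ] using ha
    simpa [dist_eq_norm] using this.le.trans (min_le_right _ _)
  · intro y
    have hd1 : DifferentiableAt ℝ (φ.normed volume ⋆[ContinuousLinearMap.lsmul ℝ ℝ, volume] ψ : E → ℝ) y :=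
      (hsm.differentiable (by simp)) y
    have hd2 : DifferentiableAt ℝ ψ y := hψ.differentiable (by simp) y
    rw [← fderiv_sub hd1 hd2]
    refine norm_fderiv_le_of_lip' ℝ hε.le (Eventually.of_forall fun x => ?_)
    refine moll_aux φ hψ.continuous x y (c := ε * ‖x - y‖) ψ hψ.continuous ?_
    intro t ht
    have ht' : ‖t‖ < η := by
      have : ‖t‖ < ρ := by simpa [φ] using ht
      exact this.trans_le (min_le_left _ _)
    have hd : ∀ z, HasFDerivAt (fun z => ψ (z - t) - ψ z) (fderiv ℝ ψ (z - t) - fderiv ℝ ψ z) z := by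
      intro z
      have a1 := (hψ.differentiable (by simp) (z - t)).hasFDerivAt
      have a2 := (hψ.differentiable (by simp) z).hasFDerivAt
      have := a1.comp z ((hasFDerivAt_id z).sub_const t)
      exact this.sub a2
    refine (convex_univ).norm_image_sub_le_of_norm_hasFDerivWithin_le
      (fun z _ => (hd z).hasFDerivWithinAt) (fun z _ => ?_) (mem_univ y) (mem_univ x)
    rw [← dist_eq_norm]
    exact (hu (by simpa [dist_eq_norm] using ht')).le

end Core


section Core
set_option linter.unusedSectionVars false
open Filter
variable {E : Type*} [NormedAddCommGroup E] [InnerProductSpace ℝ E] [FiniteDimensional ℝ E]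
  [MeasurableSpace E] [BorelSpace E]
variable {F : Type*} [NormedAddCommGroup F] [NormedSpace ℝ F]

def trc (M : E →L[ℝ] E) : ℝ := LinearMap.trace ℝ E (M : E →ₗ[ℝ] E)

lemma trc_eq (M : E →L[ℝ] E) :
    trc M = ∑ i, inner ℝ (stdOrthonormalBasis ℝ E i) (M (stdOrthonormalBasis ℝ E i)) := by
  rw [trc, LinearMap.trace_eq_sum_inner _ (stdOrthonormalBasis ℝ E)]
  rfl

lemma trc_add (M N : E →L[ℝ] E) : trc (M + N) = trc M + trc N := by simp [trc]

lemma trc_smul (a : ℝ) (N : E →L[ℝ] E) : trc (a • N) = a * trc N := by simp [trc]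

lemma trc_smulRight (l : E →L[ℝ] ℝ) (b : E) : trc (l.smulRight b) = l b := by
  rw [trc_eq]
  have h := (stdOrthonormalBasis ℝ E).sum_repr' b
  conv_rhs => rw [← h]
  rw [map_sum]
  refine Finset.sum_congr rfl fun i _ => ?_
  simp [inner_smul_right, mul_comm]

lemma trc_abs_le (M : E →L[ℝ] E) : |trc M| ≤ Module.finrank ℝ E * ‖M‖ := by
  rw [trc_eq]
  refine (Finset.abs_sum_le_sum_abs _ _).trans ?_
  refine (Finset.sum_le_sum (g := fun _ => ‖M‖) fun i _ => ?_).trans (by simp)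
  refine (abs_real_inner_le_norm _ _).trans ?_
  have h := M.le_opNorm (stdOrthonormalBasis ℝ E i)
  simpa using h

lemma trc_continuous : Continuous (trc : (E →L[ℝ] E) → ℝ) := by
  have : (trc : (E →L[ℝ] E) → ℝ) = fun M => ∑ i, inner ℝ (stdOrthonormalBasis ℝ E i) (M (stdOrthonormalBasis ℝ E i)) := by
    ext M; exact trc_eq M
  rw [this]
  fun_prop

lemma div_zero_int {X : E → E} (hX : ContDiff ℝ 1 X) (hc : HasCompactSupport X) :
    ∫ y, trc (fderiv ℝ X y) = 0 := by
  simp only [trc_eq]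
  have hcont : Continuous (fderiv ℝ X) := hX.continuous_fderiv (by norm_num)
  have hcs : ∀ u w : E, HasCompactSupport (fun y => inner ℝ u (fderiv ℝ X y w)) := by
    intro u w
    refine (hc.fderiv ℝ).comp_left (g := fun M : E →L[ℝ] E => inner ℝ u (M w)) (by simp)
  have hint : ∀ u w : E, Integrable (fun y => inner ℝ u (fderiv ℝ X y w)) := by
    intro u w
    refine Continuous.integrable_of_hasCompactSupport (by fun_prop) (hcs u w)
  rw [integral_finsetSum _ (fun i _ => hint _ _)]
  refine Finset.sum_eq_zero fun i _ => ?_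
  set b := stdOrthonormalBasis ℝ E i
  have hd : ∀ y, fderiv ℝ (fun y => inner ℝ b (X y)) y b = inner ℝ b (fderiv ℝ X y b) := by
    intro y
    have h1 := (hX.differentiable (by simp) y).hasFDerivAt
    have h2 := ((innerSL ℝ b).hasFDerivAt (x := X y)).comp y h1
    have : HasFDerivAt (fun y => inner ℝ b (X y)) ((innerSL ℝ b).comp (fderiv ℝ X y)) y := h2
    rw [this.fderiv]; rfl
  have := integral_mul_fderiv_eq_neg_fderiv_mul_of_integrable (μ := (volume : Measure E))
    (f := fun _ : E => (1 : ℝ)) (g := fun y => inner ℝ b (X y)) (v := b)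
    (by simp) (by simpa [hd] using hint b b) (by
      simp only [one_mul]
      refine Continuous.integrable_of_hasCompactSupport ?_ ?_
      · have := hX.continuous; fun_prop
      · exact hc.comp_left (g := fun z : E => inner ℝ b z) (by simp)) 
    (by simp) (by
      intro x _
      have h1 := hX.differentiable (by simp) x
      exact (innerSL ℝ b).differentiableAt.comp x h1)
  simpa [hd] using this

lemma det_differentiable : Differentiable ℝ (fun N : E →L[ℝ] E => N.det) := by
  set b := Module.finBasis ℝ E
  have : (fun N : E →L[ℝ] E => N.det) = fun N : E →L[ℝ] E => 
      ∑ σ : Equiv.Perm (Fin (Module.finrank ℝ E)), (Equiv.Perm.sign σ : ℝ) * 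
        ∏ i, LinearMap.toContinuousLinearMap (b.coord (σ i)) (N (b i)) := by
    ext N
    rw [ContinuousLinearMap.det, ← LinearMap.det_toMatrix b, Matrix.det_apply']
    simp [LinearMap.toMatrix_apply]
  rw [this]
  refine Differentiable.fun_sum fun σ _ => ?_
  refine Differentiable.const_mul ?_ _
  have key : ∀ i, Differentiable ℝ (fun N : E →L[ℝ] E => LinearMap.toContinuousLinearMap (b.coord (σ i)) (N (b i))) := ?_
  · have : ContDiff ℝ 1 (fun N : E →L[ℝ] E => ∏ i, LinearMap.toContinuousLinearMap (b.coord (σ i)) (N (b i))) := by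
      refine contDiff_prod fun i _ => ?_
      exact ((LinearMap.toContinuousLinearMap (b.coord (σ i))).comp (ContinuousLinearMap.apply ℝ E (b i))).contDiff
    exact this.differentiable (by simp)
  intro i
  have : Differentiable ℝ (fun N : E →L[ℝ] E => N (b i)) := 
    (ContinuousLinearMap.apply ℝ E (b i)).differentiable
  exact (LinearMap.toContinuousLinearMap (b.coord (σ i))).differentiable.comp this

lemma det_lim (M : E →L[ℝ] E) {t : ℕ → ℝ} (ht : Tendsto t atTop (𝓝 0)) (ht0 : ∀ n, t n ≠ 0) :
    Tendsto (fun n => ((1 + t n • M : E →L[ℝ] E).det - 1) / t n) atTop (𝓝 (trc M)) := by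
  set b := Module.finBasis ℝ E
  have h : ∀ s : ℝ, (1 + s • M : E →L[ℝ] E).det = 
    1 + Matrix.trace (LinearMap.toMatrix b b M) * s + 
    Polynomial.eval s ((1 + (Polynomial.X : Polynomial ℝ) • (LinearMap.toMatrix b b (M : E →ₗ[ℝ] E)).map Polynomial.C).det).divX.divX * s ^ 2 := by
    intro s
    rw [← Matrix.det_one_add_smul, ContinuousLinearMap.det, ← LinearMap.det_toMatrix b]
    congr 1
    have : ((1 + s • M : E →L[ℝ] E) : E →ₗ[ℝ] E) = 1 + s • (M : E →ₗ[ℝ] E) := rfl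
    rw [this, map_add, map_smul, LinearMap.toMatrix_one]
  set P := ((1 + (Polynomial.X : Polynomial ℝ) • (LinearMap.toMatrix b b (M : E →ₗ[ℝ] E)).map Polynomial.C).det).divX.divX
  have h2 : ∀ n, ((1 + t n • M : E →L[ℝ] E).det - 1) / t n = trc M + P.eval (t n) * t n := by
    intro n
    rw [h, trc, LinearMap.trace_eq_matrix_trace ℝ b]
    field_simp [ht0 n]
    ring
  simp only [h2]
  have : Tendsto (fun n => trc M + P.eval (t n) * t n) atTop (𝓝 (trc M + P.eval 0 * 0)) := 
    tendsto_const_nhds.add (((P.continuous.tendsto 0).comp ht).mul ht)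
  simpa using this

lemma det_bd (C : ℝ) : ∃ K, ∃ t0 > (0 : ℝ), ∀ t : ℝ, 0 < t → t < t0 → ∀ M : E →L[ℝ] E, ‖M‖ ≤ C → 
    |((1 + t • M : E →L[ℝ] E).det - 1) / t| ≤ K := by
  have h := (det_differentiable (E := E) 1).hasFDerivAt
  have h1 := h.isBigO_sub
  obtain ⟨c, hc⟩ := h1.bound
  rw [Metric.eventually_nhds_iff] at hc
  obtain ⟨ε, hε, hc⟩ := hc
  refine ⟨|c| * |C|, ε / (|C| + 1), by positivity, ?_⟩
  intro t ht0 ht M hM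
  have hM' : ‖M‖ ≤ |C| := hM.trans (le_abs_self _)
  have h3 : ‖t • M‖ ≤ t * |C| := by
    rw [norm_smul, Real.norm_of_nonneg ht0.le]; gcongr
  have h4 := hc (y := 1 + t • M) (by
    rw [dist_eq_norm, add_sub_cancel_left]
    rw [lt_div_iff₀ (by positivity)] at ht
    nlinarith)
  rw [add_sub_cancel_left] at h4
  have h5 : ContinuousLinearMap.det (1 : E →L[ℝ] E) = 1 := by
    change LinearMap.det (LinearMap.id : E →ₗ[ℝ] E) = 1
    exact LinearMap.det_id
  rw [h5, Real.norm_eq_abs] at h4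
  rw [abs_div, abs_of_pos ht0, div_le_iff₀ ht0]
  have : c * ‖t • M‖ ≤ |c| * (t * |C|) := by
    calc c * ‖t • M‖ ≤ |c| * ‖t • M‖ := by gcongr; exact le_abs_self _
    _ ≤ _ := by gcongr
  linarith

lemma glue {f : E → F} {r R : ℝ} (hr : r < R) (hf : ContDiffOn ℝ 1 f (ball 0 R))
    (h0 : ∀ y, r ≤ ‖y‖ → f y = 0) : ContDiff ℝ 1 f ∧ HasCompactSupport f ∧ 
      tsupport f ⊆ closedBall 0 r := by
  have hs : tsupport f ⊆ closedBall 0 r := by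
    refine closure_minimal ?_ isClosed_closedBall
    intro y hy
    by_contra h
    simp only [mem_closedBall, dist_zero_right, not_le] at h
    exact hy (h0 y h.le)
  refine ⟨?_, HasCompactSupport.of_support_subset_isCompact (isCompact_closedBall 0 r) 
    ((subset_tsupport f).trans hs), hs⟩
  rw [contDiff_iff_contDiffAt]
  intro y
  by_cases hy : y ∈ ball (0 : E) R
  · exact hf.contDiffAt (isOpen_ball.mem_nhds hy)
  · have : f =ᶠ[𝓝 y] fun _ => 0 := by
      have hU : y ∈ (closedBall (0 : E) r)ᶜ := by
        simp only [mem_ball, dist_zero_right, not_lt] at hy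
        simp; linarith
      filter_upwards [isClosed_closedBall.isOpen_compl.mem_nhds hU] with z hz
      refine h0 z ?_
      simp at hz
      exact hz.le
    exact contDiffAt_const.congr_of_eventuallyEq this

def dcut (n : ℕ) (t : ℝ) : ℝ := min 1 (max 0 ((n : ℝ) * t))
def gcut (n : ℕ) (t : ℝ) : ℝ := ∫ s in (0 : ℝ)..t, dcut n s

lemma dcut_cont (n : ℕ) : Continuous (dcut n) := by unfold dcut; fun_prop
lemma dcut_nonneg (n : ℕ) (t : ℝ) : 0 ≤ dcut n t := le_min zero_le_one (le_max_left _ _)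
lemma dcut_le (n : ℕ) (t : ℝ) : dcut n t ≤ 1 := min_le_left _ _
lemma dcut_lim {t : ℝ} (ht : 0 < t) : Tendsto (fun n => dcut n t) atTop (𝓝 1) := by
  refine tendsto_const_nhds.congr' ?_
  obtain ⟨N, hN⟩ := exists_nat_gt (1 / t)
  filter_upwards [eventually_ge_atTop N] with n hn
  have : (N : ℝ) ≤ n := by exact_mod_cast hn
  have h2 : 1 ≤ (n : ℝ) * t := by
    rw [div_lt_iff₀ ht] at hN; nlinarith
  simp [dcut, h2]
lemma gcut_deriv (n : ℕ) (t : ℝ) : HasDerivAt (gcut n) (dcut n t) t := 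
  intervalIntegral.integral_hasDerivAt_right ((dcut_cont n).intervalIntegrable _ _)
    ((dcut_cont n).stronglyMeasurableAtFilter _ _) (dcut_cont n).continuousAt
lemma gcut_contDiff (n : ℕ) : ContDiff ℝ 1 (gcut n) := by
  rw [contDiff_one_iff_deriv]
  refine ⟨fun t => (gcut_deriv n t).differentiableAt, ?_⟩
  have : deriv (gcut n) = dcut n := by ext t; exact (gcut_deriv n t).deriv
  rw [this]; exact dcut_cont n
lemma gcut_zero (n : ℕ) {t : ℝ} (ht : t ≤ 0) : gcut n t = 0 := by
  unfold gcut
  rw [intervalIntegral.integral_symm, intervalIntegral.integral_of_le ht]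
  rw [setIntegral_eq_zero_of_forall_eq_zero]; · simp
  intro s hs
  have : (n : ℝ) * s ≤ 0 := mul_nonpos_of_nonneg_of_nonpos (by positivity) hs.2
  simp [dcut, this]
lemma gcut_mono (n : ℕ) : Monotone (gcut n) := 
  monotone_of_deriv_nonneg (fun t => (gcut_deriv n t).differentiableAt) 
    (fun t => by rw [(gcut_deriv n t).deriv]; exact dcut_nonneg n t)
lemma gcut_nonneg (n : ℕ) (t : ℝ) : 0 ≤ gcut n t := by
  rcases le_total t 0 with h | h
  · rw [gcut_zero n h]
  · rw [← gcut_zero n le_rfl]; exact gcut_mono n h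
lemma gcut_le (n : ℕ) {t : ℝ} (ht : 0 ≤ t) : gcut n t ≤ t := by
  have h := intervalIntegral.integral_mono_on (a := 0) (b := t) (f := dcut n) (g := fun _ => (1 : ℝ)) ht
    ((dcut_cont n).intervalIntegrable _ _) (continuous_const.intervalIntegrable (μ := volume) 0 t) (fun s _ => dcut_le n s)
  simpa [gcut] using h
lemma gcut_lim {t : ℝ} (ht : 0 < t) : Tendsto (fun n => gcut n t) atTop (𝓝 t) := by
  have h : Tendsto (fun n => gcut n t) atTop (𝓝 (∫ _ in (0 : ℝ)..t, (1 : ℝ))) := by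
    refine intervalIntegral.tendsto_integral_filter_of_dominated_convergence (fun _ => (1 : ℝ)) ?_ ?_ ?_ ?_
    · exact Eventually.of_forall fun n => (dcut_cont n).aestronglyMeasurable
    · refine Eventually.of_forall fun n => Eventually.of_forall fun s _ => ?_
      rw [Real.norm_of_nonneg (dcut_nonneg n s)]; exact dcut_le n s
    · simp
    · refine Eventually.of_forall fun s hs => dcut_lim ?_
      rw [uIoc_of_le ht.le] at hs; exact hs.1
  simpa using h

def sphG (f : E → ℝ) (s : ℝ) : ℝ :=
  s ^ (Module.finrank ℝ E - 1) * ∫ w, f (s • (w : E)) ∂((volume : Measure E).toSphere)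

lemma polar_int [Nontrivial E] {h : E → ℝ} (hi : Integrable h) :
    IntegrableOn (sphG h) (Ioi 0) ∧ ∫ y, h y = ∫ s in Ioi (0 : ℝ), sphG h s := by
  set μ : Measure E := volume
  set d := Module.finrank ℝ E
  have hmp := μ.measurePreserving_homeomorphUnitSphereProd
  set g : sphere (0 : E) 1 × Ioi (0 : ℝ) → ℝ := fun z => h ((z.2 : ℝ) • (z.1 : E)) with hg
  have hgc : ∀ x : ({(0)}ᶜ : Set E), g (homeomorphUnitSphereProd E x) = h x := by
    intro x
    simp only [hg]
    congr 1
    have hx : ‖(x : E)‖ ≠ 0 := fun h => x.2 (by simpa using h)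
    simp [smul_smul, hx]
  have e1 : ∫ y, h y = ∫ z, g z ∂(μ.toSphere.prod (.volumeIoiPow (d - 1))) := by
    rw [← hmp.integral_comp (Homeomorph.measurableEmbedding _) g]
    simp only [hgc]
    rw [integral_subtype_comap (measurableSet_singleton _).compl fun x ↦ h x,
        restrict_compl_singleton]
  have i1 : Integrable g (μ.toSphere.prod (.volumeIoiPow (d - 1))) := by
    rw [← hmp.integrable_comp_emb (Homeomorph.measurableEmbedding _)]
    have : g ∘ (homeomorphUnitSphereProd E) = h ∘ (Subtype.val) := by
      ext x; exact hgc x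
    rw [this, ← integrableOn_iff_comap_subtypeVal (by measurability)]
    exact hi.integrableOn
  have i2 := i1.integral_prod_right
  rw [integral_prod_symm _ i1] at e1
  simp only [Measure.volumeIoiPow, ENNReal.ofReal] at i2 e1
  have key : ∀ x : Ioi (0 : ℝ), ((x : ℝ) ^ (d - 1)).toNNReal • ∫ (x_1 : sphere (0 : E) 1), g (x_1, x) ∂μ.toSphere 
      = sphG h x := by
    intro x
    rw [NNReal.smul_def, Real.coe_toNNReal _ (pow_nonneg (le_of_lt x.2) _)]
    rfl
  rw [integral_withDensity_eq_integral_smul (by fun_prop)] at e1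
  rw [integrable_withDensity_iff_integrable_smul (by fun_prop)] at i2
  simp only [key] at e1 i2
  constructor
  · rw [integrableOn_iff_comap_subtypeVal (by measurability)]
    exact i2
  · rw [e1, integral_subtype_comap measurableSet_Ioi (sphG h)]

lemma polar_deriv_base [Nontrivial E] {f : E → ℝ} {R : ℝ} (hf : ContinuousOn f (ball 0 R \ {0}))
    (hi : ∀ s < R, IntegrableOn f (ball 0 s)) {r : ℝ} (hr : 0 < r) (hrR : r < R) :
    HasDerivAt (fun s => ∫ y in ball (0 : E) s, f y) (sphG f r) r := by
  obtain ⟨r0, h1, h2⟩ := exists_between hrR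
  have norm_sm : ∀ (s : ℝ), 0 < s → ∀ w : sphere (0 : E) 1, ‖s • (w : E)‖ = s := by
    intro s hs w
    rw [norm_smul, norm_eq_of_mem_sphere, mul_one, Real.norm_of_nonneg hs.le]
  have hind : ∀ s ≤ r0, ∀ τ > 0, sphG ((ball (0 : E) s).indicator f) τ = (Iio s).indicator (sphG f) τ := by
    intro s hs τ hτ
    by_cases h : τ < s
    · simp only [sphG, indicator, mem_ball, dist_zero_right, norm_sm τ hτ, mem_Iio, h, if_true]
    · simp only [sphG, indicator, mem_ball, dist_zero_right, norm_sm τ hτ, mem_Iio, h, if_false]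
      simp
  have hII : IntegrableOn (sphG f) (Ioo 0 r0) := by
    have := (polar_int ((integrable_indicator_iff measurableSet_ball).2 (hi r0 h2))).1
    refine (this.mono_set (Ioo_subset_Ioi_self)).congr_fun ?_ measurableSet_Ioo
    intro τ hτ
    rw [hind r0 le_rfl τ hτ.1, indicator_of_mem (show τ ∈ Iio r0 from hτ.2)]
  have heq : ∀ s, 0 < s → s < r0 → ∫ y in ball (0 : E) s, f y = ∫ τ in (0 : ℝ)..s, sphG f τ := by
    intro s hs0 hs
    rw [← integral_indicator measurableSet_ball]
    rw [(polar_int ((integrable_indicator_iff measurableSet_ball).2 (hi s (hs.trans h2)))).2]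
    rw [setIntegral_congr_fun measurableSet_Ioi (g := (Iio s).indicator (sphG f)) 
      (fun τ hτ => hind s hs.le τ hτ)]
    rw [setIntegral_indicator measurableSet_Iio, Ioi_inter_Iio, intervalIntegral.integral_of_le hs0.le,
      integral_Ioc_eq_integral_Ioo]
  have hcont : ContinuousOn (sphG f) (Ioo 0 R) := by
    unfold sphG
    refine (continuousOn_pow _).mul ?_
    have := continuousOn_integral_of_compact_support (μ := (volume : Measure E).toSphere) 
      (f := fun (τ : ℝ) (w : sphere (0 : E) 1) => f (τ • (w : E))) (s := Ioo 0 R) (k := univ)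
      isCompact_univ ?_ (by simp)
    · exact this
    · refine hf.comp (by fun_prop) ?_
      rintro ⟨τ, w⟩ ⟨hτ, -⟩
      have hn := norm_sm τ hτ.1 w
      refine ⟨by simpa [hn] using hτ.2, ?_⟩
      simp only [mem_singleton_iff]
      intro h0
      rw [h0, norm_zero] at hn
      exact hτ.1.ne hn
  have hca : ContinuousAt (sphG f) r := hcont.continuousAt (Ioo_mem_nhds hr hrR)
  have hd : HasDerivAt (fun s => ∫ τ in (0 : ℝ)..s, sphG f τ) (sphG f r) r := by
    refine intervalIntegral.integral_hasDerivAt_right ?_ ?_ hca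
    · rw [intervalIntegrable_iff_integrableOn_Ioo_of_le hr.le]
      exact hII.mono_set (Ioo_subset_Ioo_right h1.le)
    · exact hcont.stronglyMeasurableAtFilter isOpen_Ioo r ⟨hr, hrR⟩
  refine hd.congr_of_eventuallyEq ?_
  filter_upwards [Ioo_mem_nhds hr h1] with s hs
  exact heq s hs.1 hs.2

lemma polar_deriv [Nontrivial E] {f : E → ℝ} {R : ℝ} (hf : ContinuousOn f (ball 0 R \ {0}))
    (hi : ∀ s < R, IntegrableOn f (ball 0 s)) {r : ℝ} (hr : 0 < r) (hrR : r < R) 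
    {q : ℝ → ℝ} (hq : Continuous q) :
      HasDerivAt (fun s => ∫ y in ball (0 : E) s, q ‖y‖ * f y) (q r * sphG f r) r := by
  have := polar_deriv_base (f := fun y => q ‖y‖ * f y) (R := R) 
    ((hq.comp continuous_norm).continuousOn.mul hf) ?_ hr hrR
  · convert this using 1
    unfold sphG
    have norm_sm : ∀ w : sphere (0 : E) 1, ‖r • (w : E)‖ = r := by
      intro w
      rw [norm_smul, norm_eq_of_mem_sphere, mul_one, Real.norm_of_nonneg hr.le]
    simp only [norm_sm]
    rw [integral_const_mul]; ring
  · intro s hs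
    have h1 := (isCompact_closedBall (0 : E) s).exists_bound_of_continuousOn 
      (f := fun y => q ‖y‖) (hq.comp continuous_norm).continuousOn
    obtain ⟨C, hC⟩ := h1
    refine (hi s hs).bdd_mul (c := C) (hq.comp continuous_norm).aestronglyMeasurable ?_
    filter_upwards [ae_restrict_mem measurableSet_ball] with y hy
    exact hC y (ball_subset_closedBall hy)

end Core


section Core
set_option linter.unusedSectionVars false
open Filter
variable {E : Type*} [NormedAddCommGroup E] [InnerProductSpace ℝ E] [FiniteDimensional ℝ E]
  [MeasurableSpace E] [BorelSpace E]

structure Core (T : E → E →L[ℝ] E) (v : E → ℝ) (p : E → E) (L Λ M R : ℝ) : Prop where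
  hL : 0 ≤ L
  hΛ : 1 ≤ Λ
  hM : 1 ≤ M
  hR : 0 < R
  hR1 : R ≤ 1
  lip : ∀ y z, ‖T y - T z‖ ≤ L * ‖y - z‖
  sym : ∀ y ∈ ball (0 : E) R, ∀ a b, inner ℝ (T y a) b = inner ℝ a (T y b)
  ell : ∀ y ∈ ball (0 : E) R, ∀ a, Λ⁻¹ * ‖a‖ ^ 2 ≤ inner ℝ (T y a) a
  bdd : ∀ y ∈ ball (0 : E) R, ‖T y‖ ≤ M
  grad : ∀ y ∈ ball (0 : E) R, HasFDerivAt v (innerSL ℝ (p y)) y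
  cont : ContinuousOn p (ball (0 : E) R)
  weak : ∀ ψ : E → ℝ, ContDiff ℝ ∞ ψ → HasCompactSupport ψ → tsupport ψ ⊆ ball 0 R →
    ∫ y in ball (0 : E) R, fderiv ℝ ψ y (T y (p y)) = 0

lemma intB {G : Type*} [NormedAddCommGroup G] {f : E → G} {r R : ℝ} (hf : ContinuousOn f (ball 0 R)) (hr : r < R) :
    IntegrableOn f (ball 0 r) :=
  ((hf.mono (closedBall_subset_ball hr)).integrableOn_compact (isCompact_closedBall _ _)).mono_set
    ball_subset_closedBall

lemma intB0 [Nontrivial E] {f g : E → ℝ} {r R : ℝ} (hf : ContinuousOn f (ball 0 R \ {0}))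
    (hg : ContinuousOn g (ball 0 R)) (hfg : ∀ y ∈ ball (0 : E) R, |f y| ≤ g y) (hr : r < R) :
    IntegrableOn f (ball 0 r) := by
  refine Integrable.mono' (intB hg hr) ?_ ?_
  · have h1 : AEStronglyMeasurable f (volume.restrict (ball (0 : E) r \ {0})) :=
      (hf.mono (sdiff_subset_sdiff_left (ball_subset_ball hr.le))).aestronglyMeasurable 
        (measurableSet_ball.diff (measurableSet_singleton _))
    have h2 : (ball (0 : E) r \ {0} : Set E) =ᵐ[volume] ball (0 : E) r :=
      sdiff_null_ae_eq_self (measure_singleton _)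
    rwa [Measure.restrict_congr_set h2] at h1
  · filter_upwards [ae_restrict_mem measurableSet_ball] with y hy
    exact hfg y (ball_subset_ball hr.le hy)

lemma cut_hasFDerivAt (n : ℕ) (r : ℝ) (y : E) :
    HasFDerivAt (fun y : E => gcut n (r ^ 2 - ‖y‖ ^ 2))
      ((-2 * dcut n (r ^ 2 - ‖y‖ ^ 2)) • innerSL ℝ y) y := by
  have h1 : HasFDerivAt (fun y : E => ‖y‖ ^ 2) (2 • innerSL ℝ y) y :=
    (hasStrictFDerivAt_norm_sq y).hasFDerivAt
  have h2 := (gcut_deriv n (r ^ 2 - ‖y‖ ^ 2)).comp_hasFDerivAt y (h1.const_sub (r ^ 2))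
  refine h2.congr_fderiv ?_
  ext w
  simp
  ring

lemma cut_contDiff (n : ℕ) (r : ℝ) : ContDiff ℝ 1 (fun y : E => gcut n (r ^ 2 - ‖y‖ ^ 2)) :=
  (gcut_contDiff n).comp (contDiff_const.sub (contDiff_norm_sq ℝ))

lemma cut_out (n : ℕ) {r : ℝ} (hr : 0 ≤ r) {y : E} (hy : r ≤ ‖y‖) : gcut n (r ^ 2 - ‖y‖ ^ 2) = 0 :=
  gcut_zero n (by nlinarith)

lemma dcut_out (n : ℕ) {r : ℝ} (hr : 0 ≤ r) {y : E} (hy : r ≤ ‖y‖) : dcut n (r ^ 2 - ‖y‖ ^ 2) = 0 := by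
  have : (n : ℝ) * (r ^ 2 - ‖y‖ ^ 2) ≤ 0 := mul_nonpos_of_nonneg_of_nonpos (by positivity) (by nlinarith)
  simp [dcut, this]

lemma cut_lim {r : ℝ} {Fn Gn : ℕ → E → ℝ} {F G bF bG : E → ℝ}
    (hFm : ∀ n, AEStronglyMeasurable (Fn n) (volume.restrict (ball 0 r)))
    (hGm : ∀ n, AEStronglyMeasurable (Gn n) (volume.restrict (ball 0 r)))
    (hbF : IntegrableOn bF (ball 0 r)) (hbG : IntegrableOn bG (ball 0 r))
    (hF : ∀ n, ∀ y ∈ ball (0 : E) r, |Fn n y| ≤ bF y) (hG : ∀ n, ∀ y ∈ ball (0 : E) r, |Gn n y| ≤ bG y)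
    (hFl : ∀ᵐ y, y ∈ ball (0 : E) r → Tendsto (fun n => Fn n y) atTop (𝓝 (F y)))
    (hGl : ∀ᵐ y, y ∈ ball (0 : E) r → Tendsto (fun n => Gn n y) atTop (𝓝 (G y))) :
    Tendsto (fun n => ∫ y in ball (0 : E) r, (gcut n (r ^ 2 - ‖y‖ ^ 2) * Fn n y + dcut n (r ^ 2 - ‖y‖ ^ 2) * Gn n y))
      atTop (𝓝 (∫ y in ball (0 : E) r, ((r ^ 2 - ‖y‖ ^ 2) * F y + G y))) := by
  refine tendsto_integral_of_dominated_convergence (fun y => r ^ 2 * bF y + bG y) ?_ ?_ ?_ ?_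
  · intro n
    refine AEStronglyMeasurable.add ?_ ?_
    · exact (cut_contDiff n r).continuous.aestronglyMeasurable.mul (hFm n)
    · refine Continuous.aestronglyMeasurable ?_ |>.mul (hGm n)
      have := dcut_cont n
      fun_prop
  · exact (hbF.const_mul _).add hbG
  · intro n
    filter_upwards [ae_restrict_mem measurableSet_ball] with y hy
    have hy' : ‖y‖ < r := by simpa using hy
    have hp : 0 ≤ r ^ 2 - ‖y‖ ^ 2 := by nlinarith [norm_nonneg y]
    have h1 := gcut_le n hp
    have h2 := gcut_nonneg n (r ^ 2 - ‖y‖ ^ 2)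
    have h3 := dcut_le n (r ^ 2 - ‖y‖ ^ 2)
    have h4 := dcut_nonneg n (r ^ 2 - ‖y‖ ^ 2)
    refine (norm_add_le _ _).trans ?_
    rw [norm_mul, norm_mul, Real.norm_of_nonneg h2, Real.norm_of_nonneg h4, Real.norm_eq_abs, Real.norm_eq_abs]
    have h5 : gcut n (r ^ 2 - ‖y‖ ^ 2) ≤ r ^ 2 := by nlinarith [sq_nonneg ‖y‖]
    have h6 := mul_le_mul h5 (hF n y hy) (abs_nonneg _) (sq_nonneg r)
    have h7 := mul_le_mul h3 (hG n y hy) (abs_nonneg _) zero_le_one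
    linarith
  · rw [ae_restrict_iff' measurableSet_ball]
    filter_upwards [hFl, hGl] with y h1 h2 hy
    have hy' : ‖y‖ < r := by simpa using hy
    have hp : 0 < r ^ 2 - ‖y‖ ^ 2 := by nlinarith [norm_nonneg y]
    have := ((gcut_lim hp).mul (h1 hy)).add ((dcut_lim hp).mul (h2 hy))
    simpa using this

variable {T : E → E →L[ℝ] E} {v : E → ℝ} {p : E → E} {L Λ M R : ℝ}

namespace Core

lemma contT (h : Core T v p L Λ M R) : Continuous T := by
  have : LipschitzWith ⟨L, h.hL⟩ T := LipschitzWith.of_dist_le_mul fun y z => by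
    rw [dist_eq_norm, dist_eq_norm]; exact h.lip y z
  exact this.continuous

lemma contv (h : Core T v p L Λ M R) : ContinuousOn v (ball 0 R) :=
  fun y hy => (h.grad y hy).continuousAt.continuousWithinAt

lemma contTp (h : Core T v p L Λ M R) : ContinuousOn (fun y => T y (p y)) (ball 0 R) :=
  h.contT.continuousOn.clm_apply h.cont

lemma conte (h : Core T v p L Λ M R) : ContinuousOn (fun y => inner ℝ (T y (p y)) (p y)) (ball 0 R) :=
  h.contTp.inner h.cont

lemma cv (h : Core T v p L Λ M R) : ContDiffOn ℝ 1 v (ball 0 R) := by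
  rw [show (1 : WithTop ℕ∞) = 0 + 1 by simp, contDiffOn_succ_iff_fderiv_of_isOpen isOpen_ball]
  refine ⟨fun y hy => (h.grad y hy).differentiableAt.differentiableWithinAt, by simp, ?_⟩
  rw [contDiffOn_zero]
  refine ContinuousOn.congr (f := fun y => innerSL ℝ (p y)) ?_ fun y hy => (h.grad y hy).fderiv
  exact (innerSL ℝ).continuous.comp_continuousOn h.cont

lemma weak1 (h : Core T v p L Λ M R) {ψ : E → ℝ} (hψ : ContDiff ℝ 1 ψ) (hc : HasCompactSupport ψ)
    {s : ℝ} (hs0 : 0 ≤ s) (hs : s < R) (hsup : tsupport ψ ⊆ closedBall 0 s) :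
    ∫ y in ball (0 : E) R, fderiv ℝ ψ y (T y (p y)) = 0 := by
  obtain ⟨s', h1, h2⟩ := exists_between hs
  have hsub : closedBall (0 : E) s' ⊆ ball 0 R := closedBall_subset_ball h2
  have hcTp := h.contTp.mono hsub
  set C := ∫ y in closedBall (0 : E) s', ‖T y (p y)‖
  have hC0 : 0 ≤ C := integral_nonneg fun _ => norm_nonneg _
  have red : ∀ g : E → ℝ, tsupport g ⊆ closedBall 0 s' →
      ∫ y in ball (0 : E) R, fderiv ℝ g y (T y (p y)) = ∫ y in closedBall (0 : E) s', fderiv ℝ g y (T y (p y)) := by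
    intro g hg
    refine (setIntegral_eq_of_subset_of_forall_sdiff_eq_zero measurableSet_ball hsub ?_)
    intro y hy
    have : y ∉ tsupport (fderiv ℝ g) := fun hh => hy.2 (hg (tsupport_fderiv_subset ℝ hh))
    rw [image_eq_zero_of_notMem_tsupport this]; simp
  have key : ∀ ε > 0, |∫ y in ball (0 : E) R, fderiv ℝ ψ y (T y (p y))| ≤ ε * C := by
    intro ε hε
    obtain ⟨g, hg, hgs, hgd⟩ := moll_C1 hψ hc hε (sub_pos.2 h1)
    have hgs' : tsupport g ⊆ closedBall 0 s' := by
      refine hgs.trans ((cthickening_mono le_rfl _).trans ?_)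
      refine (cthickening_subset_of_subset _ hsup).trans ?_
      rw [cthickening_closedBall (sub_pos.2 h1).le hs0]
      simp
    have hgc : HasCompactSupport g := HasCompactSupport.of_support_subset_isCompact (isCompact_closedBall 0 s')
      ((subset_tsupport g).trans hgs')
    have w := h.weak g hg hgc (hgs'.trans hsub)
    rw [red g hgs'] at w
    rw [red ψ (hsup.trans (closedBall_subset_closedBall h1.le))]
    have ii : ∀ g : E → ℝ, ContDiff ℝ 1 g → IntegrableOn (fun y => fderiv ℝ g y (T y (p y))) (closedBall 0 s') := by
      intro g hg
      refine ContinuousOn.integrableOn_compact (isCompact_closedBall _ _) ?_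
      exact (hg.continuous_fderiv (by simp)).continuousOn.clm_apply hcTp
    have e : ∫ y in closedBall (0 : E) s', fderiv ℝ ψ y (T y (p y)) = 
        ∫ y in closedBall (0 : E) s', (fderiv ℝ ψ y (T y (p y)) - fderiv ℝ g y (T y (p y))) := by
      rw [integral_sub (ii ψ hψ) (ii g (hg.of_le (by simp))), w, sub_zero]
    rw [e, ← Real.norm_eq_abs, ← integral_const_mul]
    refine norm_integral_le_of_norm_le ?_ (Eventually.of_forall fun y => ?_)
    · exact (hcTp.norm.integrableOn_compact (isCompact_closedBall _ _)).const_mul _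
    · rw [← _root_.sub_apply]
      refine (ContinuousLinearMap.le_opNorm _ _).trans ?_
      gcongr
      rw [norm_sub_rev]; exact hgd y
  by_contra hne
  have hpos := abs_pos.2 hne
  have := key (|∫ y in ball (0 : E) R, fderiv ℝ ψ y (T y (p y))| / (2 * (C + 1))) (by positivity)
  rw [div_mul_eq_mul_div, le_div_iff₀ (by positivity)] at this
  nlinarith

lemma E1 (h : Core T v p L Λ M R) {r : ℝ} (hr : 0 < r) (hrR : r < R) :
    ∫ y in ball (0 : E) r, (r ^ 2 - ‖y‖ ^ 2) * inner ℝ (T y (p y)) (p y) = 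
      ∫ y in ball (0 : E) r, 2 * (v y * inner ℝ (T y (p y)) y) := by
  have hsub : ball (0 : E) r ⊆ ball 0 R := ball_subset_ball hrR.le
  have ce := h.conte
  have cw : ContinuousOn (fun y => -2 * (v y * inner ℝ (T y (p y)) y)) (ball 0 R) :=
    continuousOn_const.mul (h.contv.mul (h.contTp.inner continuousOn_id))
  have ie := intB ce hrR
  have iw := intB cw hrR
  have lim := cut_lim (r := r) (Fn := fun _ y => inner ℝ (T y (p y)) (p y)) 
    (Gn := fun _ y => -2 * (v y * inner ℝ (T y (p y)) y)) (fun _ => ie.1) (fun _ => iw.1)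
    ie.abs iw.abs (fun _ _ _ => le_rfl) (fun _ _ _ => le_rfl) 
    (Eventually.of_forall fun y _ => tendsto_const_nhds) (Eventually.of_forall fun y _ => tendsto_const_nhds)
  have z : ∀ n, ∫ y in ball (0 : E) r, (gcut n (r ^ 2 - ‖y‖ ^ 2) * inner ℝ (T y (p y)) (p y)
      + dcut n (r ^ 2 - ‖y‖ ^ 2) * (-2 * (v y * inner ℝ (T y (p y)) y))) = 0 := by
    intro n
    obtain ⟨g1, g2, g3⟩ := glue hrR (f := fun y => gcut n (r ^ 2 - ‖y‖ ^ 2) * v y) 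
      ((cut_contDiff n r).contDiffOn.mul h.cv) (fun y hy => by rw [cut_out n hr.le hy, zero_mul])
    rw [← h.weak1 g1 g2 hr.le hrR g3]
    have fd : ∀ y ∈ ball (0 : E) R, fderiv ℝ (fun y => gcut n (r ^ 2 - ‖y‖ ^ 2) * v y) y (T y (p y)) = 
      gcut n (r ^ 2 - ‖y‖ ^ 2) * inner ℝ (T y (p y)) (p y)
      + dcut n (r ^ 2 - ‖y‖ ^ 2) * (-2 * (v y * inner ℝ (T y (p y)) y)) := by
      intro y hy
      rw [((cut_hasFDerivAt n r y).fun_mul (h.grad y hy)).fderiv]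
      simp [real_inner_comm]
      ring
    rw [setIntegral_congr_fun measurableSet_ball (g := fun y => gcut n (r ^ 2 - ‖y‖ ^ 2) * inner ℝ (T y (p y)) (p y)
      + dcut n (r ^ 2 - ‖y‖ ^ 2) * (-2 * (v y * inner ℝ (T y (p y)) y))) fd]
    symm
    refine setIntegral_eq_of_subset_of_forall_sdiff_eq_zero measurableSet_ball hsub ?_
    intro y hy
    have : r ≤ ‖y‖ := by simpa using hy.2
    rw [cut_out n hr.le this, dcut_out n hr.le this]; simp
  simp only [z] at lim
  have := tendsto_nhds_unique lim tendsto_const_nhds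
  rw [integral_add] at this
  · have e2 : ∫ y in ball (0 : E) r, 2 * (v y * inner ℝ (T y (p y)) y) = - ∫ y in ball (0 : E) r, -2 * (v y * inner ℝ (T y (p y)) y) := by
      rw [← integral_neg]; congr 1; ext y; ring
    linarith
  · refine intB (R := R) ?_ hrR
    exact ContinuousOn.mul (by fun_prop) ce
  · exact iw

end Core
end Core


section Core
set_option linter.unusedSectionVars false
open Filter
variable {E : Type*} [NormedAddCommGroup E] [InnerProductSpace ℝ E] [FiniteDimensional ℝ E]
  [MeasurableSpace E] [BorelSpace E]
variable {T : E → E →L[ℝ] E} {v : E → ℝ} {p : E → E} {L Λ M R : ℝ}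

def mu (T : E → E →L[ℝ] E) (y : E) : ℝ := inner ℝ (T y y) y / ‖y‖ ^ 2

lemma deriv_weighted [Nontrivial E] {f : E → ℝ} {R : ℝ} (hf : ContinuousOn f (ball 0 R))
    {r : ℝ} (hr : 0 < r) (hrR : r < R) :
    HasDerivAt (fun s => ∫ y in ball (0 : E) s, (s ^ 2 - ‖y‖ ^ 2) * f y) (2 * r * ∫ y in ball (0 : E) r, f y) r := by
  have h1 := polar_deriv (hf.mono sdiff_subset) (fun s hs => intB hf hs) hr hrR (q := fun _ => 1) continuous_const
  have h2 := polar_deriv (hf.mono sdiff_subset) (fun s hs => intB hf hs) hr hrR (q := fun t => t ^ 2) (by fun_prop)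
  have h3 := ((hasDerivAt_pow 2 r).fun_mul h1).fun_sub h2
  have e : (fun s => ∫ y in ball (0 : E) s, (s ^ 2 - ‖y‖ ^ 2) * f y) =ᶠ[𝓝 r] 
      (fun s => s ^ 2 * (∫ y in ball (0 : E) s, 1 * f y) - ∫ y in ball (0 : E) s, ‖y‖ ^ 2 * f y) := by
    filter_upwards [Iio_mem_nhds hrR] with s hs
    have hs : s < R := hs
    rw [← integral_const_mul, ← integral_sub]
    · congr 1; ext y; ring
    · simpa using (intB hf hs).const_mul (s ^ 2)
    · exact intB (R := R) (ContinuousOn.mul (by fun_prop) hf) hs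
  refine (h3.congr_of_eventuallyEq e).congr_deriv ?_
  simp

lemma mono_deriv {f : ℝ → ℝ} {f' r R : ℝ} (hr : 0 < r) (hrR : r < R) 
    (hm : ∀ a b, 0 < a → a < b → b < R → f a ≤ f b) (hd : HasDerivAt f f' r) : 0 ≤ f' := by
  have h1 : MonotoneOn f (Ioo 0 R) := by
    intro a ha b hb hab
    rcases hab.eq_or_lt with h | h
    · rw [h]
    · exact hm a b ha.1 h hb.2
  have := h1.derivWithin_nonneg (x := r)
  rwa [derivWithin_of_isOpen isOpen_Ioo ⟨hr, hrR⟩, hd.deriv] at this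

namespace Core

lemma moll (h : Core T v p L Λ M R) : ∃ B : ℕ → E → E →L[ℝ] E, (∀ n, ContDiff ℝ 1 (B n)) ∧ 
    (∀ n y, ‖B n y - T y‖ ≤ 1 / ((n : ℝ) + 1)) ∧ (∀ n y, ‖fderiv ℝ (B n) y‖ ≤ L) := by
  have := fun n : ℕ => moll_lip h.hL h.lip (δ := 1 / ((n : ℝ) + 1)) (by positivity)
  choose B h1 h2 h3 using this
  exact ⟨B, h1, h2, h3⟩

lemma moll_lim {B : ℕ → E → E →L[ℝ] E} (hB : ∀ n y, ‖B n y - T y‖ ≤ 1 / ((n : ℝ) + 1)) (y : E) :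
    Tendsto (fun n => B n y) atTop (𝓝 (T y)) := by
  rw [tendsto_iff_norm_sub_tendsto_zero]
  exact squeeze_zero (fun _ => norm_nonneg _) (fun n => hB n y) tendsto_one_div_add_atTop_nhds_zero_nat

lemma id2 (h : Core T v p L Λ M R) {B : E → E →L[ℝ] E} (hB : ContDiff ℝ 1 B) (n : ℕ) {r : ℝ} (hr : 0 < r) (hrR : r < R) :
    ∫ y in ball (0 : E) r, (gcut n (r ^ 2 - ‖y‖ ^ 2) * (-2 * (v y * inner ℝ (p y) (B y y))) + 
      dcut n (r ^ 2 - ‖y‖ ^ 2) * (2 * (v y ^ 2 * inner ℝ (B y y) y))) = 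
    ∫ y in ball (0 : E) r, gcut n (r ^ 2 - ‖y‖ ^ 2) * (v y ^ 2 * trc (B y + (fderiv ℝ B y).flip y)) := by
  have hsub : ball (0 : E) r ⊆ ball 0 R := ball_subset_ball hrR.le
  have cBy : ContDiff ℝ 1 (fun y => B y y) := hB.clm_apply contDiff_id
  obtain ⟨g1, g2, g3⟩ := glue hrR (f := fun y => (gcut n (r ^ 2 - ‖y‖ ^ 2) * v y ^ 2) • B y y) 
      (((cut_contDiff n r).contDiffOn.mul (h.cv.pow 2)).smul cBy.contDiffOn) 
      (fun y hy => by rw [cut_out n hr.le hy, zero_mul, zero_smul])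
  have fd : ∀ y ∈ ball (0 : E) R, trc (fderiv ℝ (fun y => (gcut n (r ^ 2 - ‖y‖ ^ 2) * v y ^ 2) • B y y) y) = 
     gcut n (r ^ 2 - ‖y‖ ^ 2) * (v y ^ 2 * trc (B y + (fderiv ℝ B y).flip y)) - 
     (gcut n (r ^ 2 - ‖y‖ ^ 2) * (-2 * (v y * inner ℝ (p y) (B y y))) + 
      dcut n (r ^ 2 - ‖y‖ ^ 2) * (2 * (v y ^ 2 * inner ℝ (B y y) y))) := by
    intro y hy
    have d1 := (cut_hasFDerivAt n r y).fun_mul ((h.grad y hy).pow 2)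
    have d2 : HasFDerivAt (fun y => B y y) (B y + (fderiv ℝ B y).flip y) y := 
      ((hB.differentiable (by simp) y).hasFDerivAt).clm_apply (hasFDerivAt_id y)
    have d3 := HasFDerivAt.fun_smul d1 d2
    rw [HasFDerivAt.fderiv d3, trc_add, trc_smulRight, trc_smul]
    simp [real_inner_comm]
    ring
  have z := div_zero_int g1 g2
  have e1 : ∫ y, trc (fderiv ℝ (fun y => (gcut n (r ^ 2 - ‖y‖ ^ 2) * v y ^ 2) • B y y) y) = 
      ∫ y in ball (0 : E) r, trc (fderiv ℝ (fun y => (gcut n (r ^ 2 - ‖y‖ ^ 2) * v y ^ 2) • B y y) y) := by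
    symm
    refine setIntegral_eq_integral_of_forall_compl_eq_zero ?_
    intro y hy
    have hy' : r ≤ ‖y‖ := by simpa using hy
    by_cases hyR : y ∈ ball (0 : E) R
    · rw [fd y hyR, cut_out n hr.le hy', dcut_out n hr.le hy']; simp
    · have : y ∉ tsupport (fderiv ℝ (fun y => (gcut n (r ^ 2 - ‖y‖ ^ 2) * v y ^ 2) • B y y)) := fun hh => 
        hyR (closedBall_subset_ball hrR (g3 (tsupport_fderiv_subset ℝ hh)))
      rw [image_eq_zero_of_notMem_tsupport this]; simp [trc]
  rw [e1, setIntegral_congr_fun measurableSet_ball (fun y hy => fd y (hsub hy)), integral_sub] at z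
  · linarith
  · refine intB (R := R) ?_ hrR
    refine (cut_contDiff n r).continuous.continuousOn.mul ((h.contv.pow 2).mul ?_)
    refine (trc_continuous.comp ?_).continuousOn
    have c1 := hB.continuous
    have c2 := hB.continuous_fderiv (by simp)
    exact c1.add (((ContinuousLinearMap.flipₗᵢ ℝ E E E).continuous.comp c2).clm_apply continuous_id)
  · refine intB (R := R) ?_ hrR
    have c1 := cBy.continuous.continuousOn (s := ball (0 : E) R)
    refine ContinuousOn.add ?_ ?_
    · exact (cut_contDiff n r).continuous.continuousOn.mul (continuousOn_const.mul (h.contv.mul (h.cont.inner c1)))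
    · refine ContinuousOn.mul ?_ (continuousOn_const.mul ((h.contv.pow 2).mul (c1.inner continuousOn_id)))
      have := dcut_cont n
      exact Continuous.continuousOn (by fun_prop)

def Wf (T : E → E →L[ℝ] E) (v : E → ℝ) (p : E → E) (r : ℝ) : ℝ :=
  ∫ y in ball (0 : E) r, ((r ^ 2 - ‖y‖ ^ 2) * (-2 * (v y * inner ℝ (p y) (T y y))) + 2 * (v y ^ 2 * inner ℝ (T y y) y))

lemma step2a (h : Core T v p L Λ M R) {r1 r2 : ℝ} (hr1 : 0 < r1) (hr : r1 < r2) (hr2 : r2 < R) :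
    |Wf T v p r2 - Wf T v p r1| ≤ (Module.finrank ℝ E * (M + 1 + L)) * 
      ((∫ y in ball (0 : E) r2, (r2 ^ 2 - ‖y‖ ^ 2) * v y ^ 2) - ∫ y in ball (0 : E) r1, (r1 ^ 2 - ‖y‖ ^ 2) * v y ^ 2) := by
  obtain ⟨B, B1, B2, B3⟩ := h.moll
  set C := Module.finrank ℝ E * (M + 1 + L)
  have hn1 : ∀ n : ℕ, 1 / ((n : ℝ) + 1) ≤ 1 := by
    intro n; rw [div_le_one (by positivity)]; linarith [n.cast_nonneg (α := ℝ)]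
  have hBb : ∀ n, ∀ y ∈ ball (0 : E) R, ‖B n y‖ ≤ M + 1 := by
    intro n y hy
    have a1 := h.bdd y hy
    have a2 := (B2 n y).trans (hn1 n)
    have := norm_le_norm_add_norm_sub' (B n y) (T y)
    linarith
  have hnn : ∀ y ∈ ball (0 : E) R, ‖y‖ ≤ 1 := by
    intro y hy
    have : ‖y‖ < R := by simpa using hy
    linarith [h.hR1]
  have limW : ∀ r, 0 < r → r < R → Tendsto (fun n => ∫ y in ball (0 : E) r, (gcut n (r ^ 2 - ‖y‖ ^ 2) * (-2 * (v y * inner ℝ (p y) (B n y y))) + 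
      dcut n (r ^ 2 - ‖y‖ ^ 2) * (2 * (v y ^ 2 * inner ℝ (B n y y) y)))) atTop (𝓝 (Wf T v p r)) := by
    intro r hr hrR
    have hsub : ball (0 : E) r ⊆ ball 0 R := ball_subset_ball hrR.le
    have cB : ∀ n, ContinuousOn (fun y => B n y y) (ball 0 R) := fun n => 
      ((B1 n).continuous.clm_apply continuous_id).continuousOn
    have nBy : ∀ n, ∀ y ∈ ball (0 : E) R, ‖B n y y‖ ≤ M + 1 := by
      intro n y hy
      have := (B n y).le_opNorm y
      have a1 := hBb n y hy
      have a2 := hnn y hy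
      have : ‖B n y‖ * ‖y‖ ≤ (M + 1) * 1 := mul_le_mul a1 a2 (norm_nonneg _) (by linarith [h.hM])
      linarith
    refine cut_lim (bF := fun y => 2 * (|v y| * (‖p y‖ * (M + 1)))) (bG := fun y => 2 * (v y ^ 2 * ((M + 1) * 1))) ?_ ?_ ?_ ?_ ?_ ?_ ?_ ?_
    · intro n
      exact (intB (R := R) (continuousOn_const.mul (h.contv.mul (h.cont.inner (cB n)))) hrR).1
    · intro n
      exact (intB (R := R) (continuousOn_const.mul ((h.contv.pow 2).mul ((cB n).inner continuousOn_id))) hrR).1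
    · exact intB (R := R) (continuousOn_const.mul (h.contv.abs.mul (h.cont.norm.mul continuousOn_const))) hrR
    · exact intB (R := R) (continuousOn_const.mul ((h.contv.pow 2).mul continuousOn_const)) hrR
    · intro n y hy
      rw [abs_mul, abs_mul]
      norm_num
      refine mul_le_mul_of_nonneg_left ?_ (abs_nonneg _)
      refine (abs_real_inner_le_norm _ _).trans ?_
      exact mul_le_mul_of_nonneg_left (nBy n y (hsub hy)) (norm_nonneg _)
    · intro n y hy
      rw [abs_mul, abs_mul, abs_of_nonneg (sq_nonneg (v y)), abs_two]
      refine mul_le_mul_of_nonneg_left (mul_le_mul_of_nonneg_left ?_ (sq_nonneg _)) zero_le_two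
      refine (abs_real_inner_le_norm _ _).trans ?_
      exact mul_le_mul (nBy n y (hsub hy)) (hnn y (hsub hy)) (norm_nonneg _) (by linarith [h.hM])
    · refine Eventually.of_forall fun y hy => ?_
      have := (ContinuousLinearMap.apply ℝ E y).continuous.continuousAt.tendsto.comp (moll_lim B2 y)
      exact tendsto_const_nhds.mul (tendsto_const_nhds.mul (tendsto_const_nhds.inner this))
    · refine Eventually.of_forall fun y hy => ?_
      have := (ContinuousLinearMap.apply ℝ E y).continuous.continuousAt.tendsto.comp (moll_lim B2 y)
      exact tendsto_const_nhds.mul (tendsto_const_nhds.mul (this.inner tendsto_const_nhds))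
  have limP : ∀ r, 0 < r → r < R → Tendsto (fun n => ∫ y in ball (0 : E) r, gcut n (r ^ 2 - ‖y‖ ^ 2) * v y ^ 2) atTop 
      (𝓝 (∫ y in ball (0 : E) r, (r ^ 2 - ‖y‖ ^ 2) * v y ^ 2)) := by
    intro r hr hrR
    have iv : IntegrableOn (fun y => v y ^ 2) (ball (0 : E) r) := intB (h.contv.pow 2) hrR
    have := cut_lim (r := r) (Fn := fun _ y => v y ^ 2) (Gn := fun _ _ => 0) (G := fun _ => 0) (bG := fun _ => 0) (fun _ => iv.1)
      (fun _ => aestronglyMeasurable_const) iv.abs (by simp) (fun _ _ _ => le_rfl) (by simp) 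
      (Eventually.of_forall fun y _ => tendsto_const_nhds) (by simp)
    simpa using this
  have trB : ∀ n, ∀ y ∈ ball (0 : E) R, |trc (B n y + (fderiv ℝ (B n) y).flip y)| ≤ C := by
    intro n y hy
    refine (trc_abs_le _).trans ?_
    refine mul_le_mul_of_nonneg_left ?_ (by positivity)
    refine (norm_add_le _ _).trans (add_le_add (hBb n y hy) ?_)
    refine ((fderiv ℝ (B n) y).flip.le_opNorm y).trans ?_
    rw [ContinuousLinearMap.opNorm_flip]
    have := mul_le_mul (B3 n y) (hnn y hy) (norm_nonneg _) h.hL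
    linarith
  have hr1R := hr.trans hr2
  have hr20 := hr1.trans hr
  have ext : ∀ n (f : E → ℝ), ∫ y in ball (0 : E) r1, gcut n (r1 ^ 2 - ‖y‖ ^ 2) * f y = ∫ y in ball (0 : E) r2, gcut n (r1 ^ 2 - ‖y‖ ^ 2) * f y := by
    intro n f
    symm
    refine setIntegral_eq_of_subset_of_forall_sdiff_eq_zero measurableSet_ball (ball_subset_ball hr.le) ?_
    intro y hy
    have : r1 ≤ ‖y‖ := by simpa using hy.2
    rw [cut_out n hr1.le this, zero_mul]
  refine le_of_tendsto_of_tendsto (((limW r2 hr20 hr2).sub (limW r1 hr1 hr1R)).abs)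
    (((limP r2 hr20 hr2).sub (limP r1 hr1 hr1R)).const_mul C) (Eventually.of_forall fun n => ?_)
  simp only
  rw [h.id2 (B1 n) n hr20 hr2, h.id2 (B1 n) n hr1 hr1R, ext, ext]
  have ct : ContinuousOn (fun y => trc (B n y + (fderiv ℝ (B n) y).flip y)) (ball (0 : E) R) := by
    refine (trc_continuous.comp ?_).continuousOn
    have c1 := (B1 n).continuous
    have c2 := (B1 n).continuous_fderiv (by simp)
    exact c1.add (((ContinuousLinearMap.flipₗᵢ ℝ E E E).continuous.comp c2).clm_apply continuous_id)
  have ii : ∀ r, IntegrableOn (fun y => gcut n (r ^ 2 - ‖y‖ ^ 2) * (v y ^ 2 * trc (B n y + (fderiv ℝ (B n) y).flip y))) (ball 0 r2) := 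
    fun r => intB (R := R) ((cut_contDiff n r).continuous.continuousOn.mul ((h.contv.pow 2).mul ct)) hr2
  have jj : ∀ r, IntegrableOn (fun y => gcut n (r ^ 2 - ‖y‖ ^ 2) * (v y ^ 2)) (ball 0 r2) := 
    fun r => intB (R := R) ((cut_contDiff n r).continuous.continuousOn.mul ((h.contv.pow 2))) hr2
  rw [← integral_sub (ii r2) (ii r1), ← integral_sub (jj r2) (jj r1), ← integral_const_mul, ← Real.norm_eq_abs]
  refine norm_integral_le_of_norm_le (((jj r2).sub (jj r1)).const_mul C) ?_
  filter_upwards [ae_restrict_mem measurableSet_ball] with y hy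
  have m : gcut n (r1 ^ 2 - ‖y‖ ^ 2) ≤ gcut n (r2 ^ 2 - ‖y‖ ^ 2) := gcut_mono n (by nlinarith)
  rw [← sub_mul, ← sub_mul, norm_mul, norm_mul, Real.norm_of_nonneg (sub_nonneg.2 m), Real.norm_of_nonneg (sq_nonneg (v y)), Real.norm_eq_abs]
  have := trB n y (ball_subset_ball hr2.le hy)
  calc _ ≤ (gcut n (r2 ^ 2 - ‖y‖ ^ 2) - gcut n (r1 ^ 2 - ‖y‖ ^ 2)) * (v y ^ 2 * C) := by
        gcongr
    _ = _ := by ring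

lemma mu_cont (h : Core T v p L Λ M R) : ContinuousOn (mu T) {0}ᶜ := by
  unfold mu
  have := h.contT
  refine ContinuousOn.div (Continuous.continuousOn ?_) (by fun_prop) ?_
  · exact (this.clm_apply continuous_id).inner continuous_id
  · intro y hy
    have : y ≠ 0 := hy
    positivity

lemma mu_le (h : Core T v p L Λ M R) {y : E} (hy : y ∈ ball 0 R) : |mu T y| ≤ M := by
  unfold mu
  rw [abs_div, abs_of_nonneg (sq_nonneg ‖y‖)]
  refine div_le_of_le_mul₀ (by positivity) (by linarith [h.hM]) ?_
  refine (abs_real_inner_le_norm _ _).trans ?_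
  have := (T y).le_of_opNorm_le (h.bdd y hy) y
  nlinarith [norm_nonneg y]

lemma mu_ge (h : Core T v p L Λ M R) {y : E} (hy : y ∈ ball 0 R) (h0 : y ≠ 0) : Λ⁻¹ ≤ mu T y := by
  unfold mu
  rw [le_div_iff₀ (by positivity)]
  exact h.ell y hy y

def Hc (T : E → E →L[ℝ] E) (v : E → ℝ) (r : ℝ) : ℝ := ∫ y in ball (0 : E) r, mu T y * v y ^ 2
def Dc (T : E → E →L[ℝ] E) (p : E → E) (r : ℝ) : ℝ := 
  ∫ y in ball (0 : E) r, (r ^ 2 - ‖y‖ ^ 2) * inner ℝ (T y (p y)) (p y)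

lemma cmv (h : Core T v p L Λ M R) : ContinuousOn (fun y => mu T y * v y ^ 2) (ball 0 R \ {0}) :=
  (h.mu_cont.mono (fun _ hy => hy.2)).mul ((h.contv.pow 2).mono sdiff_subset)

lemma imv [Nontrivial E] (h : Core T v p L Λ M R) {r : ℝ} (hr : r < R) : IntegrableOn (fun y => mu T y * v y ^ 2) (ball 0 r) := by
  refine intB0 h.cmv (g := fun y => M * v y ^ 2) (continuousOn_const.mul (h.contv.pow 2)) ?_ hr
  intro y hy
  rw [abs_mul, abs_of_nonneg (sq_nonneg (v y))]
  exact mul_le_mul_of_nonneg_right (h.mu_le hy) (sq_nonneg _)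

lemma Hc_deriv [Nontrivial E] (h : Core T v p L Λ M R) {r : ℝ} (hr : 0 < r) (hrR : r < R) : 
    HasDerivAt (Hc T v) (sphG (fun y => mu T y * v y ^ 2) r) r := 
  polar_deriv_base h.cmv (fun _ hs => h.imv hs) hr hrR

lemma K_le [Nontrivial E] (h : Core T v p L Λ M R) {r : ℝ} (hrR : r < R) : 
    ∫ y in ball (0 : E) r, v y ^ 2 ≤ Λ * Hc T v r := by
  rw [Hc, ← integral_const_mul]
  refine setIntegral_mono_ae_restrict (intB (h.contv.pow 2) hrR) ((h.imv hrR).const_mul _) ?_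
  have : ∀ᵐ y ∂(volume.restrict (ball (0 : E) r)), y ≠ 0 := ae_restrict_of_ae (Measure.ae_ne volume 0)
  filter_upwards [this, ae_restrict_mem measurableSet_ball] with y h0 hy
  have a := h.mu_ge (ball_subset_ball hrR.le hy) h0
  have hl : 0 < Λ := by linarith [h.hΛ]
  rw [inv_le_iff_one_le_mul₀ hl] at a
  nlinarith [sq_nonneg (v y)]

lemma step2 [Nontrivial E] (h : Core T v p L Λ M R) {r : ℝ} (hr : 0 < r) (hrR : r < R) : 
    |r * deriv (Hc T v) r - Dc T p r| ≤ (Module.finrank ℝ E * (M + 1 + L)) * Λ * Hc T v r := by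
  set C := Module.finrank ℝ E * (M + 1 + L) with hC
  have hC0 : 0 ≤ C := by have := h.hM; have := h.hL; positivity
  have cw : ContinuousOn (fun y => -2 * (v y * inner ℝ (p y) (T y y))) (ball 0 R) :=
    continuousOn_const.mul (h.contv.mul (h.cont.inner (h.contT.clm_apply continuous_id).continuousOn))
  have hK := deriv_weighted (f := fun y => v y ^ 2) (h.contv.pow 2) hr hrR
  have d1 := deriv_weighted cw hr hrR
  have d2 := polar_deriv h.cmv (fun _ hs => h.imv hs) hr hrR (q := fun t => 2 * t ^ 2) (by fun_prop)
  have e : Wf T v p =ᶠ[𝓝 r] (fun s => (∫ y in ball (0 : E) s, (s ^ 2 - ‖y‖ ^ 2) * (-2 * (v y * inner ℝ (p y) (T y y)))) + 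
      ∫ y in ball (0 : E) s, (2 * ‖y‖ ^ 2) * (mu T y * v y ^ 2)) := by
    filter_upwards [Iio_mem_nhds hrR] with s hs
    have hs : s < R := hs
    have mm : ∀ y : E, (2 * ‖y‖ ^ 2) * (mu T y * v y ^ 2) = 2 * (v y ^ 2 * inner ℝ (T y y) y) := by
      intro y
      by_cases h0 : y = 0
      · simp [h0]
      · unfold mu
        have : ‖y‖ ≠ 0 := norm_ne_zero_iff.2 h0
        field_simp
    simp only [mm, Wf]
    rw [integral_add]
    · exact intB (R := R) (ContinuousOn.mul (by fun_prop) cw) hs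
    · exact intB (R := R) (continuousOn_const.mul ((h.contv.pow 2).mul 
        ((h.contT.clm_apply continuous_id).continuousOn.inner continuousOn_id))) hs
  have dW := (d1.fun_add d2).congr_of_eventuallyEq e
  have hH := h.Hc_deriv hr hrR
  rw [hH.deriv]
  set H' := sphG (fun y => mu T y * v y ^ 2) r
  have eD : ∫ y in ball (0 : E) r, -2 * (v y * inner ℝ (p y) (T y y)) = - Dc T p r := by
    rw [Dc, h.E1 hr hrR, ← integral_neg]
    refine setIntegral_congr_fun measurableSet_ball fun y hy => ?_
    rw [← h.sym y (ball_subset_ball hrR.le hy)]; ring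
  rw [eD] at dW
  set K := ∫ y in ball (0 : E) r, v y ^ 2
  have hKH : K ≤ Λ * Hc T v r := h.K_le hrR
  have m1 := mono_deriv hr hrR (fun a b ha hab hb => by
    have := (abs_le.1 (h.step2a ha hab hb)).1
    show C * (∫ y in ball (0 : E) a, (a ^ 2 - ‖y‖ ^ 2) * v y ^ 2) + Wf T v p a ≤ C * (∫ y in ball (0 : E) b, (b ^ 2 - ‖y‖ ^ 2) * v y ^ 2) + Wf T v p b
    linarith) ((hK.const_mul C).fun_add dW)
  have m2 := mono_deriv hr hrR (fun a b ha hab hb => by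
    have := (abs_le.1 (h.step2a ha hab hb)).2
    show C * (∫ y in ball (0 : E) a, (a ^ 2 - ‖y‖ ^ 2) * v y ^ 2) - Wf T v p a ≤ C * (∫ y in ball (0 : E) b, (b ^ 2 - ‖y‖ ^ 2) * v y ^ 2) - Wf T v p b
    linarith) ((hK.const_mul C).fun_sub dW)
  have n1 : 0 ≤ 2 * r * (C * K + (r * H' - Dc T p r)) := by
    have : 2 * r * (C * K + (r * H' - Dc T p r)) = C * (2 * r * K) + (2 * r * -Dc T p r + 2 * r ^ 2 * H') := by ring
    linarith
  have n2 : 0 ≤ 2 * r * (C * K - (r * H' - Dc T p r)) := by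
    have : 2 * r * (C * K - (r * H' - Dc T p r)) = C * (2 * r * K) - (2 * r * -Dc T p r + 2 * r ^ 2 * H') := by ring
    linarith
  have q1 := nonneg_of_mul_nonneg_right n1 (by linarith)
  have q2 := nonneg_of_mul_nonneg_right n2 (by linarith)
  have := mul_le_mul_of_nonneg_left hKH hC0
  rw [abs_le]
  constructor <;> linarith

end Core
end Core


section Core
set_option linter.unusedSectionVars false
open Filter
variable {E : Type*} [NormedAddCommGroup E] [InnerProductSpace ℝ E] [FiniteDimensional ℝ E]
  [MeasurableSpace E] [BorelSpace E]
variable {T : E → E →L[ℝ] E} {v : E → ℝ} {p : E → E} {L Λ M R : ℝ}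

lemma phi_facts {X : E → E} {N t r : ℝ} (hX : ∀ y z, ‖X y - X z‖ ≤ N * ‖y - z‖) (h0 : ∀ y, r ≤ ‖y‖ → X y = 0)
    (ht : 0 ≤ t) (htN : t * N ≤ 1 / 2) : Function.Injective (fun y => y + t • X y) ∧ 
     (∀ y ∈ ball (0 : E) r, y + t • X y ∈ ball (0 : E) r) ∧ (fun y => y + t • X y) '' ball 0 r = ball 0 r := by
  have hl : ∀ y z, ‖t • X y - t • X z‖ ≤ 1 / 2 * ‖y - z‖ := by
    intro y z
    rw [← smul_sub, norm_smul, Real.norm_of_nonneg ht]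
    have := mul_le_mul_of_nonneg_left (hX y z) ht
    nlinarith [norm_nonneg (y - z)]
  have inj : Function.Injective (fun y => y + t • X y) := by
    intro y z hyz
    have e : y - z = -(t • X y - t • X z) := by
      have : y + t • X y = z + t • X z := hyz
      rw [neg_sub, sub_eq_sub_iff_add_eq_add, this]; abel
    have h1 := hl y z
    rw [← norm_neg (t • X y - t • X z), ← e] at h1
    have : ‖y - z‖ = 0 := by linarith [norm_nonneg (y - z)]
    exact sub_eq_zero.1 (norm_eq_zero.1 this)
  have fx : ∀ y, y ∉ ball (0 : E) r → y + t • X y = y := by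
    intro y hy
    rw [h0 y (by simpa using hy)]; simp
  have mp : ∀ y ∈ ball (0 : E) r, y + t • X y ∈ ball (0 : E) r := by
    intro y hy
    by_contra hn
    have := inj (show (fun y => y + t • X y) (y + t • X y) = (fun y => y + t • X y) y from fx _ hn)
    have this : y + t • X y = y := this
    rw [this] at hn
    exact hn hy
  refine ⟨inj, mp, ?_⟩
  refine Subset.antisymm (image_subset_iff.2 mp) ?_
  intro z hz
  have hc : ContractingWith (1 / 2 : ℝ≥0) (fun y => z - t • X y) := by
    refine ⟨by rw [← NNReal.coe_lt_coe]; norm_num, LipschitzWith.of_dist_le_mul fun a b => ?_⟩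
    rw [dist_eq_norm, dist_eq_norm, sub_sub_sub_cancel_left, norm_sub_rev a b]
    simpa using hl b a
  have hf := hc.fixedPoint_isFixedPt
  set y := ContractingWith.fixedPoint (fun y => z - t • X y) hc
  have hy : z - t • X y = y := hf
  have hy' : y + t • X y = z := by rw [eq_comm, ← sub_eq_iff_eq_add]; exact hy
  refine ⟨y, ?_, hy'⟩
  by_contra hn
  rw [fx y hn] at hy'
  exact hn (hy' ▸ hz)

namespace Core
open ContinuousLinearMap (adjoint)

def fiv (T : E → E →L[ℝ] E) (p : E → E) (L : ℝ) (X : E → E) (t : ℝ) (y : E) : ℝ :=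
  2 * inner ℝ (p (y + t • X y)) (fderiv ℝ X y (T y (p (y + t • X y)))) +
  t * inner ℝ (T y (adjoint (fderiv ℝ X y) (p (y + t • X y)))) (adjoint (fderiv ℝ X y) (p (y + t • X y))) - 
  (((1 + t • fderiv ℝ X y : E →L[ℝ] E).det - 1) / t) * inner ℝ (T y (p (y + t • X y))) (p (y + t • X y)) + 
  (1 + t • fderiv ℝ X y : E →L[ℝ] E).det * (L * ‖X y‖ * ‖p (y + t • X y)‖ ^ 2)

lemma maps {r : ℝ} (hr : r < R) {X : E → E} {t : ℝ} (h0 : ∀ y, r ≤ ‖y‖ → X y = 0) 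
    (mp : ∀ y ∈ ball (0 : E) r, y + t • X y ∈ ball (0 : E) r) : ∀ y ∈ ball (0 : E) R, y + t • X y ∈ ball (0 : E) R := by
  intro y hy
  by_cases h : y ∈ ball (0 : E) r
  · exact ball_subset_ball hr.le (mp y h)
  · rw [h0 y (by simpa using h)]; simpa using hy

lemma contq (h : Core T v p L Λ M R) {X : E → E} (hX : Continuous X) {t : ℝ} 
    (mp : ∀ y ∈ ball (0 : E) R, y + t • X y ∈ ball (0 : E) R) : ContinuousOn (fun y => p (y + t • X y)) (ball 0 R) :=
  h.cont.comp (by fun_prop) mp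

lemma contdet {X : E → E} (hX : ContDiff ℝ 1 X) (t : ℝ) : Continuous (fun y => (1 + t • fderiv ℝ X y : E →L[ℝ] E).det) := by
  have := hX.continuous_fderiv (by simp)
  exact det_differentiable.continuous.comp (by fun_prop)

lemma contfiv (h : Core T v p L Λ M R) {X : E → E} (hX : ContDiff ℝ 1 X) {t : ℝ} 
    (mp : ∀ y ∈ ball (0 : E) R, y + t • X y ∈ ball (0 : E) R) : ContinuousOn (fiv T p L X t) (ball 0 R) := by
  have cq := h.contq hX.continuous mp
  have cT := h.contT.continuousOn (s := ball (0 : E) R)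
  have cD := (hX.continuous_fderiv (by simp)).continuousOn (s := ball (0 : E) R)
  have cS : ContinuousOn (fun y => adjoint (fderiv ℝ X y)) (ball (0 : E) R) := adjoint.continuous.comp_continuousOn cD
  have cd := (contdet hX t).continuousOn (s := ball (0 : E) R)
  have cX := hX.continuous.continuousOn (s := ball (0 : E) R)
  unfold fiv
  refine ContinuousOn.add (ContinuousOn.sub (ContinuousOn.add ?_ ?_) ?_) ?_
  · exact continuousOn_const.mul (cq.inner (cD.clm_apply (cT.clm_apply cq)))
  · exact continuousOn_const.mul ((cT.clm_apply (cS.clm_apply cq)).inner (cS.clm_apply cq))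
  · exact ((cd.sub continuousOn_const).div_const _).mul ((cT.clm_apply cq).inner cq)
  · exact cd.mul ((continuousOn_const.mul cX.norm).mul (cq.norm.pow 2))

lemma iv_t (h : Core T v p L Λ M R) {X : E → E} (hX : ContDiff ℝ 1 X) {r : ℝ} (hr : 0 < r) (hrR : r < R) 
    (h0 : ∀ y, r ≤ ‖y‖ → X y = 0) (hD0 : ∀ y, r ≤ ‖y‖ → fderiv ℝ X y = 0) {t N : ℝ} (ht : 0 < t) (hN : ∀ y z, ‖X y - X z‖ ≤ N * ‖y - z‖) (htN : t * N ≤ 1 / 2)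
    (hdet : ∀ y, 0 < (1 + t • fderiv ℝ X y : E →L[ℝ] E).det) : 0 ≤ ∫ y in ball (0 : E) r, fiv T p L X t y := by
  obtain ⟨inj, mp, im⟩ := phi_facts hN h0 ht.le htN
  have mpR := maps hrR h0 mp
  have hsub : ball (0 : E) r ⊆ ball 0 R := ball_subset_ball hrR.le
  have cq := h.contq hX.continuous mpR
  have cT := h.contT.continuousOn (s := ball (0 : E) R)
  have cD := (hX.continuous_fderiv (by simp)).continuousOn (s := ball (0 : E) R)
  have cS : ContinuousOn (fun y => adjoint (fderiv ℝ X y)) (ball (0 : E) R) := adjoint.continuous.comp_continuousOn cD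
  have dPhi : ∀ y, HasFDerivAt (fun y => y + t • X y) (1 + t • fderiv ℝ X y) y := fun y => 
    (hasFDerivAt_id y).add (((hX.differentiable (by simp)) y).hasFDerivAt.const_smul t)
  set q : E → E := fun y => p (y + t • X y) with hq
  set a : E → E := fun y => q y + t • adjoint (fderiv ℝ X y) (q y) with ha
  have ca : ContinuousOn a (ball 0 R) := cq.add (continuousOn_const.smul (cS.clm_apply cq))
  have hab : ∀ y w, inner ℝ (q y) ((1 + t • fderiv ℝ X y : E →L[ℝ] E) w) = inner ℝ (a y) w := by
    intro y w
    simp [ha, inner_add_left, inner_add_right, inner_smul_left, inner_smul_right, ContinuousLinearMap.adjoint_inner_left]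
  -- weak equation
  obtain ⟨g1, g2, g3⟩ := glue hrR (f := fun y => v (y + t • X y) - v y) 
      ((h.cv.comp (contDiff_id.add (contDiff_const.smul hX)).contDiffOn mpR).sub h.cv) 
      (fun y hy => by rw [h0 y hy]; simp)
  have w := h.weak1 g1 g2 hr.le hrR g3
  have fd : ∀ y ∈ ball (0 : E) R, fderiv ℝ (fun y => v (y + t • X y) - v y) y (T y (p y)) = 
      inner ℝ (a y) (T y (p y)) - inner ℝ (T y (p y)) (p y) := by
    intro y hy
    have d1 : HasFDerivAt (fun y => v (y + t • X y)) ((innerSL ℝ (q y)).comp (1 + t • fderiv ℝ X y)) y := 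
      (h.grad _ (mpR y hy)).comp y (dPhi y)
    rw [(d1.fun_sub (h.grad y hy)).fderiv, ← hab]
    simp [real_inner_comm, inner_add_right, inner_smul_right]
  have out : ∀ y ∈ ball (0 : E) R \ ball 0 r, fderiv ℝ (fun y => v (y + t • X y) - v y) y (T y (p y)) = 0 := by
    intro y hy
    have hy2 : r ≤ ‖y‖ := by simpa using hy.2
    have := hD0 y hy2
    rw [fd y hy.1]
    simp [ha, hq, this, h0 y hy2, real_inner_comm]
  rw [setIntegral_eq_of_subset_of_forall_sdiff_eq_zero measurableSet_ball hsub out, 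
    setIntegral_congr_fun measurableSet_ball (fun y hy => fd y (hsub hy))] at w
  have iaTp : IntegrableOn (fun y => inner ℝ (a y) (T y (p y))) (ball 0 r) := intB (ca.inner h.contTp) hrR
  have ie : IntegrableOn (fun y => inner ℝ (T y (p y)) (p y)) (ball 0 r) := intB h.conte hrR
  rw [integral_sub iaTp ie] at w
  have iTa : IntegrableOn (fun y => inner ℝ (T y (a y)) (a y)) (ball 0 r) := intB ((cT.clm_apply ca).inner ca) hrR
  -- positivity
  have pos : 0 ≤ ∫ y in ball (0 : E) r, (inner ℝ (T y (a y)) (a y) - 2 * inner ℝ (a y) (T y (p y)) + inner ℝ (T y (p y)) (p y)) := by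
    refine setIntegral_nonneg measurableSet_ball fun y hy => ?_
    have e1 := h.ell y (hsub hy) (a y - p y)
    have e0 : 0 ≤ Λ⁻¹ * ‖a y - p y‖ ^ 2 := by have := h.hΛ; positivity
    have e2 : inner ℝ (T y (a y - p y)) (a y - p y) = inner ℝ (T y (a y)) (a y) - 2 * inner ℝ (a y) (T y (p y)) + inner ℝ (T y (p y)) (p y) := by
      rw [map_sub, inner_sub_left, inner_sub_right, inner_sub_right, h.sym y (hsub hy) (a y) (p y), real_inner_comm (a y) (T y (p y))]
      ring
    linarith
  rw [integral_add (f := fun y => inner ℝ (T y (a y)) (a y) - 2 * inner ℝ (a y) (T y (p y))) (iTa.sub (iaTp.const_mul 2)) ie, integral_sub iTa (iaTp.const_mul 2), integral_const_mul] at pos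
  -- change of variables
  have cov := integral_image_eq_integral_abs_det_fderiv_smul volume (measurableSet_ball (x := (0 : E)) (ε := r))
    (fun y _ => (dPhi y).hasFDerivWithinAt) (inj.injOn) (fun y => inner ℝ (T y (p y)) (p y))
  rw [im] at cov
  have cd := (contdet hX t).continuousOn (s := ball (0 : E) R)
  have cTq : ContinuousOn (fun y => T (y + t • X y) (q y)) (ball 0 R) := by
    refine ContinuousOn.clm_apply ?_ cq
    have := h.contT
    have := hX.continuous
    exact Continuous.continuousOn (by fun_prop)
  have idet : IntegrableOn (fun y => |(1 + t • fderiv ℝ X y : E →L[ℝ] E).det| • inner ℝ (T (y + t • X y) (q y)) (q y)) (ball 0 r) := 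
    intB (cd.abs.smul (cTq.inner cq)) hrR
  have i1 : IntegrableOn (fiv T p L X t) (ball 0 r) := intB (h.contfiv hX mpR) hrR
  have fin : ∫ y in ball (0 : E) r, (inner ℝ (T y (a y)) (a y) - |(1 + t • fderiv ℝ X y : E →L[ℝ] E).det| • inner ℝ (T (y + t • X y) (q y)) (q y)) 
      ≤ ∫ y in ball (0 : E) r, t * fiv T p L X t y := by
    refine setIntegral_mono_on (iTa.sub idet) (i1.const_mul t) measurableSet_ball fun y hy => ?_
    have d0 := hdet y
    rw [abs_of_pos d0, smul_eq_mul]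
    unfold fiv
    change _ ≤ t * (2 * inner ℝ (q y) (fderiv ℝ X y (T y (q y))) + _ - _ + _)
    have e1 : inner ℝ (T y (a y)) (a y) = inner ℝ (T y (q y)) (q y) + 2 * t * inner ℝ (q y) (fderiv ℝ X y (T y (q y))) + 
        t ^ 2 * inner ℝ (T y (adjoint (fderiv ℝ X y) (q y))) (adjoint (fderiv ℝ X y) (q y)) := by
      have s1 : inner ℝ (T y (adjoint (fderiv ℝ X y) (q y))) (q y) = inner ℝ (q y) (fderiv ℝ X y (T y (q y))) := by
        rw [h.sym y (hsub hy), ContinuousLinearMap.adjoint_inner_left]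
      have s2 : inner ℝ (T y (q y)) (adjoint (fderiv ℝ X y) (q y)) = inner ℝ (q y) (fderiv ℝ X y (T y (q y))) := by
        rw [ContinuousLinearMap.adjoint_inner_right, real_inner_comm]
      simp only [ha, map_add, map_smul, inner_add_left, inner_add_right, inner_smul_left, inner_smul_right, s1, s2]
      simp; ring
    have e2 : inner ℝ (T y (q y)) (q y) - t * (L * ‖X y‖ * ‖q y‖ ^ 2) ≤ inner ℝ (T (y + t • X y) (q y)) (q y) := by
      have l1 := h.lip y (y + t • X y)
      rw [sub_add_cancel_left, norm_neg, norm_smul, Real.norm_of_nonneg ht.le] at l1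
      have l2 := (T y - T (y + t • X y)).le_of_opNorm_le l1 (q y)
      have l3 := real_inner_le_norm ((T y - T (y + t • X y)) (q y)) (q y)
      rw [sub_apply, inner_sub_left] at l3
      have l4 := mul_le_mul_of_nonneg_right l2 (norm_nonneg (q y))
      rw [sub_apply] at l4
      nlinarith
    have e3 := mul_le_mul_of_nonneg_left e2 d0.le
    set dt := (1 + t • fderiv ℝ X y : E →L[ℝ] E).det
    have e4 : t * ((dt - 1) / t) = dt - 1 := by field_simp
    have e5 : t * ((dt - 1) / t * inner ℝ (T y (q y)) (q y)) = (dt - 1) * inner ℝ (T y (q y)) (q y) := by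
      rw [← mul_assoc, e4]
    rw [e1]
    simp only [mul_add, mul_sub, e5]
    nlinarith
  rw [integral_sub iTa idet, ← cov, integral_const_mul] at fin
  have : 0 ≤ t * ∫ y in ball (0 : E) r, fiv T p L X t y := by linarith
  exact nonneg_of_mul_nonneg_right this ht

end Core
end Core


section Core
set_option linter.unusedSectionVars false
open Filter
variable {E : Type*} [NormedAddCommGroup E] [InnerProductSpace ℝ E] [FiniteDimensional ℝ E]
  [MeasurableSpace E] [BorelSpace E]
variable {T : E → E →L[ℝ] E} {v : E → ℝ} {p : E → E} {L Λ M R : ℝ}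

namespace Core
open ContinuousLinearMap (adjoint)

lemma innervar (h : Core T v p L Λ M R) {X : E → E} (hX : ContDiff ℝ 1 X) (hXc : HasCompactSupport X) {r : ℝ} (hr : 0 < r) (hrR : r < R) 
    (h0 : ∀ y, r ≤ ‖y‖ → X y = 0) (hD0 : ∀ y, r ≤ ‖y‖ → fderiv ℝ X y = 0) : 
    0 ≤ ∫ y in ball (0 : E) r, (2 * inner ℝ (p y) (fderiv ℝ X y (T y (p y))) - 
      trc (fderiv ℝ X y) * inner ℝ (T y (p y)) (p y) + L * ‖X y‖ * ‖p y‖ ^ 2) := by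
  have cD := hX.continuous_fderiv (by simp)
  obtain ⟨N, hN⟩ := (hXc.fderiv ℝ).exists_bound_of_continuous cD
  obtain ⟨XB, hXB⟩ := hXc.exists_bound_of_continuous hX.continuous
  have hN0 : 0 ≤ N := (norm_nonneg _).trans (hN 0)
  have hXB0 : 0 ≤ XB := (norm_nonneg _).trans (hXB 0)
  obtain ⟨Pm, hPm⟩ := (isCompact_closedBall (0 : E) r).exists_bound_of_continuousOn (h.cont.mono (closedBall_subset_ball hrR))
  have hPm0 : 0 ≤ Pm := (norm_nonneg _).trans (hPm 0 (by simp [hr.le]))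
  have hlip : ∀ y z, ‖X y - X z‖ ≤ N * ‖y - z‖ := fun y z => 
    Convex.norm_image_sub_le_of_norm_fderiv_le (fun x _ => (hX.differentiable (by simp)) x) (fun x _ => hN x) convex_univ (mem_univ _) (mem_univ _)
  obtain ⟨K, t0, ht0, hK⟩ := det_bd (E := E) N
  have hK0 : 0 ≤ K := (abs_nonneg _).trans (hK (t0 / 2) (by linarith) (by linarith) 0 (by simpa using hN0))
  set s0 := min (min (t0 / 2) (1 / (2 * (N + 1)))) (min (1 / (2 * (K + 1))) 1) with hs0
  have hs0p : 0 < s0 := by simp only [hs0, lt_min_iff]; refine ⟨⟨?_, ?_⟩, ?_, ?_⟩ <;> positivity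
  set t : ℕ → ℝ := fun n => s0 * (1 / ((n : ℝ) + 1)) with htd
  have htp : ∀ n, 0 < t n := fun n => by positivity
  have hts : ∀ n, t n ≤ s0 := by
    intro n
    have : 1 / ((n : ℝ) + 1) ≤ 1 := by
      rw [div_le_one (by positivity)]; linarith [n.cast_nonneg (α := ℝ)]
    simp only [htd]; nlinarith
  have ht1 : ∀ n, t n < t0 := fun n => by
    have : s0 ≤ t0 / 2 := (min_le_left _ _).trans (min_le_left _ _)
    linarith [hts n]
  have ht2 : ∀ n, t n * N ≤ 1 / 2 := fun n => by
    have : s0 ≤ 1 / (2 * (N + 1)) := (min_le_left _ _).trans (min_le_right _ _)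
    have := (hts n).trans this
    rw [le_div_iff₀ (by positivity)] at this
    nlinarith [htp n]
  have ht3 : ∀ n, t n * K ≤ 1 / 2 := fun n => by
    have : s0 ≤ 1 / (2 * (K + 1)) := (min_le_right _ _).trans (min_le_left _ _)
    have := (hts n).trans this
    rw [le_div_iff₀ (by positivity)] at this
    nlinarith [htp n]
  have ht4 : ∀ n, t n ≤ 1 := fun n => (hts n).trans ((min_le_right _ _).trans (min_le_right _ _))
  have htl : Tendsto t atTop (𝓝 0) := by
    have := (tendsto_one_div_add_atTop_nhds_zero_nat (𝕜 := ℝ)).const_mul s0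
    rw [mul_zero] at this
    exact this
  have hdK : ∀ n y, |((1 + t n • fderiv ℝ X y : E →L[ℝ] E).det - 1) / t n| ≤ K := fun n y => hK (t n) (htp n) (ht1 n) _ (hN y)
  have hd2 : ∀ n y, |(1 + t n • fderiv ℝ X y : E →L[ℝ] E).det - 1| ≤ 1 / 2 := by
    intro n y
    have := hdK n y
    rw [abs_div, abs_of_pos (htp n), div_le_iff₀ (htp n)] at this
    linarith [ht3 n]
  have hdpos : ∀ n y, 0 < (1 + t n • fderiv ℝ X y : E →L[ℝ] E).det := fun n y => by
    linarith [(abs_le.1 (hd2 n y)).1]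
  have hdle : ∀ n y, |(1 + t n • fderiv ℝ X y : E →L[ℝ] E).det| ≤ 2 := fun n y => by
    rw [abs_of_pos (hdpos n y)]; linarith [(abs_le.1 (hd2 n y)).2]
  have nn : ∀ n, 0 ≤ ∫ y in ball (0 : E) r, fiv T p L X (t n) y := fun n => 
    h.iv_t hX hr hrR h0 hD0 (htp n) hlip (ht2 n) (hdpos n)
  have mp : ∀ n, ∀ y ∈ ball (0 : E) r, y + t n • X y ∈ ball (0 : E) r := fun n => (phi_facts hlip h0 (htp n).le (ht2 n)).2.1
  have hsub : ball (0 : E) r ⊆ ball 0 R := ball_subset_ball hrR.le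
  refine ge_of_tendsto' (b := 0) (tendsto_integral_of_dominated_convergence 
    (F := fun n y => fiv T p L X (t n) y) 
    (fun _ => 2 * (Pm * (N * (M * Pm))) + 1 * ((M * (N * Pm)) * (N * Pm)) + K * ((M * Pm) * Pm) + 2 * (L * XB * Pm ^ 2)) ?_ ?_ ?_ ?_) nn
  · intro n
    exact (intB (h.contfiv hX (maps hrR h0 (mp n))) hrR).1
  · exact (integrableOn_const (by exact measure_ball_lt_top.ne))
  · intro n
    filter_upwards [ae_restrict_mem measurableSet_ball] with y hy
    have hTM := h.bdd y (hsub hy)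
    have hM0 : 0 ≤ M := (norm_nonneg _).trans hTM
    have hq := hPm _ (ball_subset_closedBall (mp n y hy))
    unfold fiv
    set q := p (y + t n • X y)
    have hTq : ‖T y q‖ ≤ M * Pm := (T y).le_of_opNorm_le_of_le hTM hq
    have hA : ‖adjoint (fderiv ℝ X y)‖ ≤ N := by rw [LinearIsometryEquiv.norm_map]; exact hN y
    have hAq : ‖adjoint (fderiv ℝ X y) q‖ ≤ N * Pm := ContinuousLinearMap.le_of_opNorm_le_of_le _ hA hq
    have hL := h.hL
    refine (norm_add_le _ _).trans (add_le_add ((norm_sub_le _ _).trans (add_le_add ((norm_add_le _ _).trans (add_le_add ?_ ?_)) ?_)) ?_)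
    · rw [norm_mul, Real.norm_of_nonneg zero_le_two]
      refine mul_le_mul_of_nonneg_left ((norm_inner_le_norm _ _).trans ?_) zero_le_two
      refine mul_le_mul hq ?_ (norm_nonneg _) hPm0
      exact ContinuousLinearMap.le_of_opNorm_le_of_le _ (hN y) hTq
    · rw [norm_mul, Real.norm_of_nonneg (htp n).le]
      refine mul_le_mul (ht4 n) ((norm_inner_le_norm _ _).trans ?_) (norm_nonneg _) zero_le_one
      refine mul_le_mul ?_ hAq (norm_nonneg _) (by positivity)
      exact ContinuousLinearMap.le_of_opNorm_le_of_le _ hTM hAq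
    · rw [norm_mul]
      refine mul_le_mul (hdK n y) ((norm_inner_le_norm _ _).trans ?_) (norm_nonneg _) hK0
      exact mul_le_mul hTq hq (norm_nonneg _) (by positivity)
    · rw [norm_mul]
      refine mul_le_mul (hdle n y) ?_ (norm_nonneg _) zero_le_two
      rw [Real.norm_of_nonneg (by positivity)]
      have := hXB y
      gcongr
  · filter_upwards [ae_restrict_mem measurableSet_ball] with y hy
    have lq : Tendsto (fun n => p (y + t n • X y)) atTop (𝓝 (p y)) := by
      have c1 : ContinuousAt p y := h.cont.continuousAt (isOpen_ball.mem_nhds (hsub hy))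
      have : Tendsto (fun n => y + t n • X y) atTop (𝓝 y) := by
        simpa using tendsto_const_nhds.add (htl.smul_const (X y))
      exact c1.tendsto.comp this
    have lTq := ((T y).continuous.tendsto (p y)).comp lq
    have lAq := ((adjoint (fderiv ℝ X y)).continuous.tendsto (p y)).comp lq
    have lTAq := ((T y).continuous.tendsto _).comp lAq
    have lDTq := ((fderiv ℝ X y).continuous.tendsto _).comp lTq
    have ld := det_lim (fderiv ℝ X y) htl (fun n => (htp n).ne')
    have ldd : Tendsto (fun n => (1 + t n • fderiv ℝ X y : E →L[ℝ] E).det) atTop (𝓝 1) := by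
      have := (ld.mul htl).add_const 1
      simp only [mul_zero, zero_add] at this
      refine this.congr fun n => ?_
      have := (htp n).ne'
      field_simp
      ring
    have := (((lq.inner lDTq).const_mul 2).add (htl.mul (lTAq.inner lAq))).sub (ld.mul (lTq.inner lq)) |>.add 
      (ldd.mul ((lq.norm.pow 2).const_mul (L * ‖X y‖)))
    simp only [zero_mul, add_zero, one_mul] at this
    exact this

/-- the radial-like vector field -/
def bet (B : E → E →L[ℝ] E) (ε : ℝ) (y : E) : E := ((‖y‖ ^ 2 + ε) * (inner ℝ (B y y) y + ε)⁻¹) • B y y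

lemma bet_facts {B : E → E →L[ℝ] E} (hB : ContDiff ℝ 1 B) {ε c M1 L : ℝ} {y : E} (hε : 0 < ε) (hc : 0 < c) (hc1 : c ≤ 1) 
    (hy : ‖y‖ ≤ 1) (hM : ‖B y‖ ≤ M1) (hL : ‖fderiv ℝ B y‖ ≤ L) (hco : c * ‖y‖ ^ 2 ≤ inner ℝ (B y y) y) :
    ‖bet B ε y‖ ≤ c⁻¹ * M1 ∧ DifferentiableAt ℝ (bet B ε) y ∧ 
    ‖fderiv ℝ (bet B ε) y‖ ≤ c⁻¹ * (M1 + L) + c⁻¹ * (2 + c⁻¹ * (L + 2 * M1)) * M1 := by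
  set m := inner ℝ (B y y) y + ε with hm
  have hM0 : 0 ≤ M1 := (norm_nonneg _).trans hM
  have hL0 : 0 ≤ L := le_trans (norm_nonneg (fderiv ℝ B y)) hL
  have hm1 : c * (‖y‖ ^ 2 + ε) ≤ m := by nlinarith
  have hmp : 0 < m := lt_of_lt_of_le (by positivity) hm1
  set f := (‖y‖ ^ 2 + ε) * m⁻¹ with hf
  have hf1 : f ≤ c⁻¹ := by
    rw [hf, ← div_eq_mul_inv, div_le_iff₀ hmp, ← div_eq_inv_mul, le_div_iff₀ hc]; linarith
  have hf0 : 0 ≤ f := by positivity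
  have hBy : ‖B y y‖ ≤ M1 * ‖y‖ := (B y).le_of_opNorm_le hM y
  have hBy1 : ‖B y y‖ ≤ M1 := hBy.trans (mul_le_of_le_one_right hM0 hy)
  have hyy : ‖y‖ * ‖y‖ * m⁻¹ ≤ c⁻¹ := by
    refine le_trans ?_ hf1
    rw [hf]
    refine mul_le_mul_of_nonneg_right (by nlinarith) (by positivity)
  refine ⟨?_, ?_⟩
  · unfold bet
    rw [norm_smul, Real.norm_of_nonneg hf0]
    exact mul_le_mul hf1 hBy1 (norm_nonneg _) (by positivity)
  have dB : HasFDerivAt (fun y => B y y) (B y + (fderiv ℝ B y).flip y) y := 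
      ((hB.differentiable (by simp) y).hasFDerivAt).clm_apply (hasFDerivAt_id y)
  set DB := B y + (fderiv ℝ B y).flip y with hDB
  have nDB : ‖DB‖ ≤ M1 + L := by
    refine (norm_add_le _ _).trans (add_le_add hM ?_)
    refine ((fderiv ℝ B y).flip.le_opNorm y).trans ?_
    rw [ContinuousLinearMap.opNorm_flip]
    have := mul_le_mul hL hy (norm_nonneg _) hL0
    linarith
  have ds : HasFDerivAt (fun y : E => ‖y‖ ^ 2 + ε) (2 • innerSL ℝ y) y :=
    (hasStrictFDerivAt_norm_sq y).hasFDerivAt.add_const ε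
  have dm : HasFDerivAt (fun y : E => inner ℝ (B y y) y + ε) 
      ((innerSL ℝ y).comp DB + innerSL ℝ (B y y)) y := by
    refine ((dB.inner ℝ (hasFDerivAt_id y)).add_const ε).congr_fderiv ?_
    ext w
    simp [real_inner_comm]
    ring
  set Dm := (innerSL ℝ y).comp DB + innerSL ℝ (B y y) with hDm
  have nDm : ‖Dm‖ ≤ (L + 2 * M1) * ‖y‖ := by
    refine (norm_add_le _ _).trans ?_
    have a1 : ‖(innerSL ℝ y).comp DB‖ ≤ ‖y‖ * (M1 + L) := by
      refine (ContinuousLinearMap.opNorm_comp_le _ _).trans ?_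
      rw [innerSL_apply_norm]
      exact mul_le_mul_of_nonneg_left nDB (norm_nonneg _)
    rw [innerSL_apply_norm]
    linarith
  have dinv : HasFDerivAt (fun y : E => (inner ℝ (B y y) y + ε)⁻¹) (-(m ^ 2)⁻¹ • Dm) y := 
    (hasDerivAt_inv hmp.ne').comp_hasFDerivAt y dm
  have dall := HasFDerivAt.fun_smul (ds.fun_mul dinv) dB
  have dall : HasFDerivAt (bet B ε) _ y := dall
  refine ⟨dall.differentiableAt, ?_⟩
  rw [dall.fderiv]
  refine (norm_add_le _ _).trans (add_le_add ?_ ?_)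
  · rw [norm_smul, Real.norm_of_nonneg hf0]
    exact mul_le_mul hf1 nDB (norm_nonneg _) (by positivity)
  · rw [ContinuousLinearMap.norm_smulRight_apply]
    have e : ‖(‖y‖ ^ 2 + ε) • (-(m ^ 2)⁻¹ • Dm) + m⁻¹ • (2 • innerSL ℝ y)‖ ≤ (2 + c⁻¹ * (L + 2 * M1)) * (‖y‖ * m⁻¹) := by
      have b1 : ‖(‖y‖ ^ 2 + ε) • (-(m ^ 2)⁻¹ • Dm)‖ ≤ c⁻¹ * (L + 2 * M1) * (‖y‖ * m⁻¹) := by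
        rw [smul_smul, norm_smul]
        have : (‖y‖ ^ 2 + ε) * -(m ^ 2)⁻¹ = - (f * m⁻¹) := by rw [hf]; field_simp
        rw [this, norm_neg, Real.norm_of_nonneg (by positivity)]
        calc f * m⁻¹ * ‖Dm‖ ≤ c⁻¹ * m⁻¹ * ((L + 2 * M1) * ‖y‖) := by gcongr
          _ = _ := by ring
      have b2 : ‖m⁻¹ • (2 • innerSL ℝ y)‖ ≤ 2 * (‖y‖ * m⁻¹) := by
        rw [norm_smul, Real.norm_of_nonneg (by positivity)]
        have : ‖2 • innerSL ℝ y‖ ≤ 2 * ‖y‖ := by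
          refine (norm_nsmul_le).trans ?_
          rw [innerSL_apply_norm]; simp
        calc m⁻¹ * ‖2 • innerSL ℝ y‖ ≤ m⁻¹ * (2 * ‖y‖) := by gcongr
          _ = _ := by ring
      refine (norm_add_le _ _).trans ?_
      linarith
    calc _ ≤ (2 + c⁻¹ * (L + 2 * M1)) * (‖y‖ * m⁻¹) * (M1 * ‖y‖) := mul_le_mul e hBy (norm_nonneg _) (by positivity)
      _ = (2 + c⁻¹ * (L + 2 * M1)) * M1 * (‖y‖ * ‖y‖ * m⁻¹) := by ring
      _ ≤ (2 + c⁻¹ * (L + 2 * M1)) * M1 * c⁻¹ := mul_le_mul_of_nonneg_left hyy (by positivity)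
      _ = _ := by ring

end Core
end Core


section Core
set_option linter.unusedSectionVars false
open Filter
variable {E : Type*} [NormedAddCommGroup E] [InnerProductSpace ℝ E] [FiniteDimensional ℝ E]
  [MeasurableSpace E] [BorelSpace E]
variable {T : E → E →L[ℝ] E} {v : E → ℝ} {p : E → E} {L Λ M R : ℝ}

namespace Core

def Cbb (Λ M : ℝ) : ℝ := ((2 * Λ)⁻¹)⁻¹ * (M + 1)
def Cbe (L Λ M : ℝ) : ℝ := ((2 * Λ)⁻¹)⁻¹ * ((M + 1) + L) + ((2 * Λ)⁻¹)⁻¹ * (2 + ((2 * Λ)⁻¹)⁻¹ * (L + 2 * (M + 1))) * (M + 1)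
def Crr (d L Λ M : ℝ) : ℝ := Λ * (2 * (Cbe L Λ M * M) + d * Cbe L Λ M * M + L * Cbb Λ M)

lemma rel_n (h : Core T v p L Λ M R) {B : E → E →L[ℝ] E} (hB : ContDiff ℝ 1 B) {ε : ℝ} (hε : 0 < ε) 
    (hBT : ∀ y, ‖B y - T y‖ ≤ (2 * Λ)⁻¹) (hBL : ∀ y, ‖fderiv ℝ B y‖ ≤ L) (n : ℕ) {r : ℝ} (hr : 0 < r) (hrR : r < R) : 
    (∀ y ∈ ball (0 : E) R, ‖bet B ε y‖ ≤ Cbb Λ M) ∧ ContinuousOn (bet B ε) (ball 0 R) ∧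
    0 ≤ ∫ y in ball (0 : E) r, (gcut n (r ^ 2 - ‖y‖ ^ 2) * (Crr (Module.finrank ℝ E) L Λ M * inner ℝ (T y (p y)) (p y)) + 
      dcut n (r ^ 2 - ‖y‖ ^ 2) * (-4 * (inner ℝ y (T y (p y)) * inner ℝ (p y) (bet B ε y)) + 
        2 * (inner ℝ y (bet B ε y) * inner ℝ (T y (p y)) (p y)))) := by
  have hΛ := h.hΛ
  have hM := h.hM
  have hL := h.hL
  have hsub : ball (0 : E) r ⊆ ball 0 R := ball_subset_ball hrR.le
  have hc : (0 : ℝ) < (2 * Λ)⁻¹ := by positivity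
  have hc1 : (2 * Λ)⁻¹ ≤ 1 := inv_le_one_of_one_le₀ (by linarith)
  have hci : (2 * Λ)⁻¹ + (2 * Λ)⁻¹ = Λ⁻¹ := by field_simp; norm_num
  have hco : ∀ y ∈ ball (0 : E) R, (2 * Λ)⁻¹ * ‖y‖ ^ 2 ≤ inner ℝ (B y y) y := by
    intro y hy
    have h1 := h.ell y hy y
    have h2 : |inner ℝ ((B y - T y) y) y| ≤ (2 * Λ)⁻¹ * ‖y‖ ^ 2 := by
      refine (abs_real_inner_le_norm _ _).trans ?_
      have := (B y - T y).le_of_opNorm_le (hBT y) y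
      nlinarith [norm_nonneg y]
    have h3 : inner ℝ ((B y - T y) y) y = inner ℝ (B y y) y - inner ℝ (T y y) y := by
      rw [_root_.sub_apply, inner_sub_left]
    rw [h3] at h2
    have := (abs_le.1 h2).1
    rw [← hci] at h1
    linarith
  have hM1 : ∀ y ∈ ball (0 : E) R, ‖B y‖ ≤ M + 1 := by
    intro y hy
    have h1 := h.bdd y hy
    have h2 : ‖B y‖ ≤ ‖B y - T y‖ + ‖T y‖ := by simpa using norm_add_le (B y - T y) (T y)
    linarith [hBT y]
  have hy1 : ∀ y ∈ ball (0 : E) R, ‖y‖ ≤ 1 := fun y hy => by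
    rw [mem_ball_zero_iff] at hy; linarith [h.hR1]
  have bf := fun y hy => bet_facts hB hε hc hc1 (hy1 y hy) (hM1 y hy) (hBL y) (hco y hy)
  have hb1 : ∀ y ∈ ball (0 : E) R, ‖bet B ε y‖ ≤ Cbb Λ M := fun y hy => (bf y hy).1
  have hb2 : ∀ y ∈ ball (0 : E) R, ‖fderiv ℝ (bet B ε) y‖ ≤ Cbe L Λ M := fun y hy => (bf y hy).2.2
  have cbet : ContDiffOn ℝ 1 (bet B ε) (ball 0 R) := by
    have b0 : ContDiff ℝ 1 (fun y => B y y) := hB.clm_apply contDiff_id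
    unfold bet
    refine ContDiffOn.smul (ContDiffOn.mul ((contDiff_norm_sq ℝ).add contDiff_const).contDiffOn (ContDiffOn.inv ?_ ?_)) b0.contDiffOn
    · exact ((b0.inner ℝ contDiff_id).add contDiff_const).contDiffOn
    · intro y hy
      have := hco y hy
      have : 0 < inner ℝ (B y y) y + ε := by
        have : 0 ≤ (2 * Λ)⁻¹ * ‖y‖ ^ 2 := by positivity
        linarith [hco y hy]
      exact this.ne'
  refine ⟨hb1, cbet.continuousOn, ?_⟩
  have hX0 : ∀ y, r ≤ ‖y‖ → gcut n (r ^ 2 - ‖y‖ ^ 2) • bet B ε y = 0 := fun y hy => by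
    rw [cut_out n hr.le hy, zero_smul]
  obtain ⟨cX, kX, sX⟩ := glue (f := fun y => gcut n (r ^ 2 - ‖y‖ ^ 2) • bet B ε y) hrR ((cut_contDiff n r).contDiffOn.smul cbet) hX0
  set X : E → E := fun y => gcut n (r ^ 2 - ‖y‖ ^ 2) • bet B ε y with hX
  have dX : ∀ y ∈ ball (0 : E) R, fderiv ℝ X y = gcut n (r ^ 2 - ‖y‖ ^ 2) • fderiv ℝ (bet B ε) y + 
      ((-2 * dcut n (r ^ 2 - ‖y‖ ^ 2)) • innerSL ℝ y).smulRight (bet B ε y) := fun y hy => 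
    ((cut_hasFDerivAt n r y).fun_smul (bf y hy).2.1.hasFDerivAt).fderiv
  have hD0 : ∀ y, r ≤ ‖y‖ → fderiv ℝ X y = 0 := by
    intro y hy
    by_cases hyR : y ∈ ball (0 : E) R
    · rw [dX y hyR, cut_out n hr.le hy, dcut_out n hr.le hy]
      ext w; simp
    · refine image_eq_zero_of_notMem_tsupport fun hh => hyR ?_
      exact closedBall_subset_ball hrR (sX (tsupport_fderiv_subset ℝ hh))
  have iv := h.innervar cX kX hr hrR hX0 hD0
  refine iv.trans (setIntegral_mono_on ?_ ?_ measurableSet_ball ?_)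
  · have cD := (cX.continuous_fderiv (by simp)).continuousOn (s := ball (0 : E) R)
    refine intB (R := R) ?_ hrR
    refine ((continuousOn_const.mul (h.cont.inner (cD.clm_apply h.contTp))).sub 
      ((trc_continuous.comp_continuousOn cD).mul h.conte)).add ?_
    exact (continuousOn_const.mul cX.continuous.continuousOn.norm).mul (h.cont.norm.pow 2)
  · refine intB (R := R) ?_ hrR
    have c1 : Continuous fun y : E => gcut n (r ^ 2 - ‖y‖ ^ 2) := (cut_contDiff n r).continuous
    have c2 : Continuous fun y : E => dcut n (r ^ 2 - ‖y‖ ^ 2) := (dcut_cont n).comp (by fun_prop)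
    refine (c1.continuousOn.mul (continuousOn_const.mul h.conte)).add (c2.continuousOn.mul ?_)
    exact (continuousOn_const.mul ((continuousOn_id.inner h.contTp).mul (h.cont.inner cbet.continuousOn))).add
      (continuousOn_const.mul ((continuousOn_id.inner cbet.continuousOn).mul h.conte))
  · intro y hy
    have hy := hsub hy
    rw [dX y hy]
    set g := gcut n (r ^ 2 - ‖y‖ ^ 2) with hg
    set dd := dcut n (r ^ 2 - ‖y‖ ^ 2) with hdd
    have g0 : 0 ≤ g := gcut_nonneg _ _
    set D := fderiv ℝ (bet B ε) y with hD
    have hXy : ‖X y‖ = g * ‖bet B ε y‖ := by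
      rw [hX]; simp only; rw [norm_smul, Real.norm_of_nonneg g0]
    rw [hXy, trc_add, trc_smul, trc_smulRight]
    simp only [_root_.add_apply, _root_.smul_apply, ContinuousLinearMap.smulRight_apply, 
      innerSL_apply_apply, inner_add_right, inner_smul_right, smul_eq_mul]
    set e := inner ℝ (T y (p y)) (p y) with he
    have key : 2 * inner ℝ (p y) (D (T y (p y))) - trc D * e + L * ‖bet B ε y‖ * ‖p y‖ ^ 2 ≤ 
        Crr (Module.finrank ℝ E) L Λ M * e := by
      have nTp : ‖T y (p y)‖ ≤ M * ‖p y‖ := (T y).le_of_opNorm_le (h.bdd y hy) _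
      have hCe : 0 ≤ Cbe L Λ M := (norm_nonneg _).trans (hb2 y hy)
      have hCb : 0 ≤ Cbb Λ M := (norm_nonneg _).trans (hb1 y hy)
      have k1 : inner ℝ (p y) (D (T y (p y))) ≤ (Cbe L Λ M * M) * ‖p y‖ ^ 2 := by
        refine (real_inner_le_norm _ _).trans ?_
        have : ‖D (T y (p y))‖ ≤ Cbe L Λ M * (M * ‖p y‖) := (D.le_of_opNorm_le (hb2 y hy) _).trans (by gcongr)
        calc ‖p y‖ * ‖D (T y (p y))‖ ≤ ‖p y‖ * (Cbe L Λ M * (M * ‖p y‖)) := by gcongr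
          _ = _ := by ring
      have k2 : |trc D * e| ≤ (Module.finrank ℝ E * Cbe L Λ M * M) * ‖p y‖ ^ 2 := by
        rw [abs_mul]
        have a1 : |trc D| ≤ Module.finrank ℝ E * Cbe L Λ M := (trc_abs_le D).trans (by gcongr; exact hb2 y hy)
        have a2 : |e| ≤ M * ‖p y‖ * ‖p y‖ := (abs_real_inner_le_norm _ _).trans (by gcongr)
        calc |trc D| * |e| ≤ (Module.finrank ℝ E * Cbe L Λ M) * (M * ‖p y‖ * ‖p y‖) := by gcongr
          _ = _ := by ring
      have k3 : L * ‖bet B ε y‖ * ‖p y‖ ^ 2 ≤ (L * Cbb Λ M) * ‖p y‖ ^ 2 := by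
        gcongr
        exact hb1 y hy
      have k4 : ‖p y‖ ^ 2 ≤ Λ * e := by
        have := h.ell y hy (p y)
        rwa [inv_mul_le_iff₀ (by positivity)] at this
      have k5 : (2 * (Cbe L Λ M * M) + Module.finrank ℝ E * Cbe L Λ M * M + L * Cbb Λ M) * ‖p y‖ ^ 2 ≤ 
          (2 * (Cbe L Λ M * M) + Module.finrank ℝ E * Cbe L Λ M * M + L * Cbb Λ M) * (Λ * e) := by
        gcongr
      have := (abs_le.1 k2).1
      unfold Crr
      linarith
    have := mul_le_mul_of_nonneg_left key g0
    linarith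

lemma bet_lim {B : ℕ → E → E →L[ℝ] E} {ε : ℕ → ℝ} {y : E} (hB : Tendsto (fun n => B n y) atTop (𝓝 (T y)))
    (hε : Tendsto ε atTop (𝓝 0)) (hne : inner ℝ (T y y) y ≠ 0) : 
    Tendsto (fun n => bet (B n) (ε n) y) atTop (𝓝 ((mu T y)⁻¹ • T y y)) := by
  have h1 : Tendsto (fun n => B n y y) atTop (𝓝 (T y y)) := ((ContinuousLinearMap.apply ℝ E y).continuous.tendsto (T y)).comp hB
  have h2 : Tendsto (fun n => (inner ℝ (B n y y) y + ε n)⁻¹) atTop (𝓝 ((inner ℝ (T y y) y + 0)⁻¹)) := by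
    refine Tendsto.inv₀ ((h1.inner tendsto_const_nhds).add hε) (by simpa using hne)
  have h3 := ((tendsto_const_nhds (x := ‖y‖ ^ 2)).add hε |>.mul h2).smul h1
  have e : (mu T y)⁻¹ = (‖y‖ ^ 2 + 0) * (inner ℝ (T y y) y + 0)⁻¹ := by
    rw [add_zero, add_zero, mu, inv_div, div_eq_mul_inv]
  rw [e]; exact h3

lemma muinv_le (h : Core T v p L Λ M R) {y : E} (hy : y ∈ ball 0 R) : 0 ≤ (mu T y)⁻¹ ∧ (mu T y)⁻¹ ≤ Λ := by
  have hΛ := h.hΛ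
  by_cases h0 : y = 0
  · subst h0; simp [mu]; linarith
  · have := h.mu_ge hy h0
    have h1 : 0 < Λ⁻¹ := by positivity
    exact ⟨by have := h1.trans_le this; positivity, inv_le_of_inv_le₀ (by positivity) this⟩

lemma iS [Nontrivial E] (h : Core T v p L Λ M R) {r : ℝ} (hr : r < R) : 
    IntegrableOn (fun y => (mu T y)⁻¹ * inner ℝ (T y (p y)) y ^ 2) (ball 0 r) := by
  have c : ContinuousOn (fun y => inner ℝ (T y (p y)) y ^ 2) (ball 0 R) := (h.contTp.inner continuousOn_id).pow 2
  refine intB0 (R := R) ?_ (g := fun y => Λ * inner ℝ (T y (p y)) y ^ 2) (continuousOn_const.mul c) ?_ hr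
  · refine ContinuousOn.mul (ContinuousOn.inv₀ (h.mu_cont.mono (fun _ hy => hy.2)) ?_) (c.mono sdiff_subset)
    intro y hy
    have := h.mu_ge hy.1 hy.2
    have h1 : 0 < Λ⁻¹ := by have := h.hΛ; positivity
    linarith
  · intro y hy
    have := h.muinv_le hy
    rw [abs_of_nonneg (mul_nonneg this.1 (sq_nonneg _))]
    exact mul_le_mul_of_nonneg_right this.2 (sq_nonneg _)

lemma step3 [Nontrivial E] (h : Core T v p L Λ M R) {r : ℝ} (hr : 0 < r) (hrR : r < R) : 
    4 * ∫ y in ball (0 : E) r, (mu T y)⁻¹ * inner ℝ (T y (p y)) y ^ 2 ≤ 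
      2 * r ^ 2 * (∫ y in ball (0 : E) r, inner ℝ (T y (p y)) (p y)) + Crr (Module.finrank ℝ E) L Λ M * Dc T p r - 2 * Dc T p r := by
  have hΛ := h.hΛ
  have hM := h.hM
  have hL := h.hL
  have hsub : ball (0 : E) r ⊆ ball 0 R := ball_subset_ball hrR.le
  have := fun n : ℕ => moll_lip h.hL h.lip (δ := (2 * Λ)⁻¹ * (1 / ((n : ℝ) + 1))) (by positivity)
  choose B hB hBT hBL using this
  have hq : ∀ n : ℕ, (2 * Λ)⁻¹ * (1 / ((n : ℝ) + 1)) ≤ (2 * Λ)⁻¹ := fun n => by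
    refine mul_le_of_le_one_right (by positivity) ?_
    rw [div_le_one (by positivity)]; linarith [(Nat.cast_nonneg n : (0 : ℝ) ≤ n)]
  have hl : Tendsto (fun n : ℕ => (2 * Λ)⁻¹ * (1 / ((n : ℝ) + 1))) atTop (𝓝 0) := by
    have := (tendsto_one_div_add_atTop_nhds_zero_nat (𝕜 := ℝ)).const_mul ((2 * Λ)⁻¹)
    rwa [mul_zero] at this
  have hBl : ∀ y, Tendsto (fun n => B n y) atTop (𝓝 (T y)) := fun y => by
    rw [tendsto_iff_norm_sub_tendsto_zero]
    exact squeeze_zero (fun _ => norm_nonneg _) (fun n => hBT n y) hl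
  set ε : ℕ → ℝ := fun n => (2 * Λ)⁻¹ * (1 / ((n : ℝ) + 1)) with hε
  have hεp : ∀ n, 0 < ε n := fun n => by rw [hε]; positivity
  have rn := fun n => h.rel_n (hB n) (hεp n) (fun y => (hBT n y).trans (hq n)) (hBL n) n hr hrR
  have hCb : 0 ≤ Cbb Λ M := by unfold Cbb; positivity
  set C := Crr (Module.finrank ℝ E) L Λ M with hC
  have lim := cut_lim (r := r) (Fn := fun _ y => C * inner ℝ (T y (p y)) (p y)) 
    (Gn := fun n y => -4 * (inner ℝ y (T y (p y)) * inner ℝ (p y) (bet (B n) (ε n) y)) + 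
        2 * (inner ℝ y (bet (B n) (ε n) y) * inner ℝ (T y (p y)) (p y)))
    (F := fun y => C * inner ℝ (T y (p y)) (p y)) 
    (G := fun y => -4 * ((mu T y)⁻¹ * inner ℝ (T y (p y)) y ^ 2) + 2 * (‖y‖ ^ 2 * inner ℝ (T y (p y)) (p y)))
    (bF := fun y => |C * inner ℝ (T y (p y)) (p y)|) 
    (bG := fun y => 4 * (‖T y (p y)‖ * (‖p y‖ * Cbb Λ M)) + 2 * (Cbb Λ M * ‖inner ℝ (T y (p y)) (p y)‖))
    (fun n => (intB (continuousOn_const.mul h.conte) hrR).aestronglyMeasurable) 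
    (fun n => ?_) (intB (continuousOn_const.mul h.conte).abs hrR) ?_ (fun n y hy => le_rfl) ?_ 
    (Eventually.of_forall fun y hy => tendsto_const_nhds) ?_
  · have := ge_of_tendsto' lim (fun n => (rn n).2.2)
    have e1 := intB h.conte hrR
    have e2 : IntegrableOn (fun y => ‖y‖ ^ 2 * inner ℝ (T y (p y)) (p y)) (ball 0 r) := 
      intB ((continuousOn_id.norm.pow 2).mul h.conte) hrR
    have e3 := h.iS hrR
    have eD : Dc T p r = r ^ 2 * (∫ y in ball (0 : E) r, inner ℝ (T y (p y)) (p y)) - 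
        ∫ y in ball (0 : E) r, ‖y‖ ^ 2 * inner ℝ (T y (p y)) (p y) := by
      unfold Dc
      rw [← integral_const_mul, ← integral_sub (e1.const_mul _) e2]
      simp only [sub_mul]
    have e4 : ∫ y in ball (0 : E) r, ((r ^ 2 - ‖y‖ ^ 2) * (C * inner ℝ (T y (p y)) (p y)) + 
        (-4 * ((mu T y)⁻¹ * inner ℝ (T y (p y)) y ^ 2) + 2 * (‖y‖ ^ 2 * inner ℝ (T y (p y)) (p y)))) = 
        C * Dc T p r + (-4 * (∫ y in ball (0 : E) r, (mu T y)⁻¹ * inner ℝ (T y (p y)) y ^ 2) + 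
          2 * ∫ y in ball (0 : E) r, ‖y‖ ^ 2 * inner ℝ (T y (p y)) (p y)) := by
      have i1 : IntegrableOn (fun y => (r ^ 2 - ‖y‖ ^ 2) * (C * inner ℝ (T y (p y)) (p y))) (ball 0 r) := 
        intB ((continuousOn_const.sub (continuousOn_id.norm.pow 2)).mul (continuousOn_const.mul h.conte)) hrR
      rw [integral_add i1 (by exact (e3.const_mul (-4)).add (e2.const_mul 2)), integral_add (e3.const_mul _) (e2.const_mul _),
        integral_const_mul, integral_const_mul]
      congr 1
      unfold Dc
      rw [← integral_const_mul]
      congr 1; ext y; ring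
    rw [e4] at this
    rw [eD] at this ⊢
    linarith
  · refine (intB (R := R) ?_ hrR).aestronglyMeasurable
    exact (continuousOn_const.mul ((continuousOn_id.inner h.contTp).mul (h.cont.inner (rn n).2.1))).add
      (continuousOn_const.mul ((continuousOn_id.inner (rn n).2.1).mul h.conte))
  · refine intB (R := R) ?_ hrR
    exact (continuousOn_const.mul (h.contTp.norm.mul (h.cont.norm.mul continuousOn_const))).add
      (continuousOn_const.mul (continuousOn_const.mul h.conte.norm))
  · intro n y hy
    have hy := hsub hy
    have hb := (rn n).1 y hy
    have hy1 : ‖y‖ ≤ 1 := by rw [mem_ball_zero_iff] at hy; linarith [h.hR1]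
    refine (abs_add_le _ _).trans (add_le_add ?_ ?_)
    · rw [abs_mul, abs_mul, abs_neg, abs_of_nonneg (by norm_num : (0 : ℝ) ≤ 4)]
      have a1 : |inner ℝ y (T y (p y))| ≤ ‖T y (p y)‖ := (abs_real_inner_le_norm _ _).trans (mul_le_of_le_one_left (norm_nonneg _) hy1)
      have a2 : |inner ℝ (p y) (bet (B n) (ε n) y)| ≤ ‖p y‖ * Cbb Λ M := (abs_real_inner_le_norm _ _).trans (by gcongr)
      gcongr
    · rw [abs_mul, abs_mul, abs_of_nonneg (by norm_num : (0 : ℝ) ≤ 2), Real.norm_eq_abs]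
      have a1 : |inner ℝ y (bet (B n) (ε n) y)| ≤ Cbb Λ M := (abs_real_inner_le_norm _ _).trans 
        ((mul_le_of_le_one_left (norm_nonneg _) hy1).trans hb)
      gcongr
  · have : ∀ᵐ y : E, y ≠ 0 := by
      rw [ae_iff]; simp
    filter_upwards [this] with y hy0 hy
    have hy := hsub hy
    have hmu := h.mu_ge hy hy0
    have hmp : 0 < mu T y := lt_of_lt_of_le (by positivity) hmu
    have hTy : inner ℝ (T y y) y = mu T y * ‖y‖ ^ 2 := by unfold mu; field_simp
    have hn : 0 < ‖y‖ := norm_pos_iff.2 hy0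
    have hne : inner ℝ (T y y) y ≠ 0 := by rw [hTy]; positivity
    have bl := bet_lim (hBl y) hl hne
    have e : -4 * ((mu T y)⁻¹ * inner ℝ (T y (p y)) y ^ 2) + 2 * (‖y‖ ^ 2 * inner ℝ (T y (p y)) (p y)) = 
       -4 * (inner ℝ y (T y (p y)) * inner ℝ (p y) ((mu T y)⁻¹ • T y y)) + 
        2 * (inner ℝ y ((mu T y)⁻¹ • T y y) * inner ℝ (T y (p y)) (p y)) := by
      rw [inner_smul_right, inner_smul_right, ← h.sym y hy (p y) y, real_inner_comm (T y (p y)) y, 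
        real_inner_comm (T y y) y, hTy]
      field_simp
    rw [e]
    exact ((tendsto_const_nhds.mul (tendsto_const_nhds.inner bl)).const_mul _).add 
      (((tendsto_const_nhds.inner bl).mul tendsto_const_nhds).const_mul _)

end Core
end Core


lemma ode_core {H D H' D' : ℝ → ℝ} {R a C r : ℝ} (m : ℕ) (hm : C + a ≤ m) (ha : 0 ≤ a) (hr : 0 < r) (hrR : 2 * r < R)
    (dH : ∀ s, 0 < s → s < R → HasDerivAt H (H' s) s) (dD : ∀ s, 0 < s → s < R → HasDerivAt D (D' s) s)
    (hD0 : ∀ s, 0 < s → s < R → 0 ≤ D s) (hH' : ∀ s, 0 < s → s < R → 0 ≤ H' s)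
    (h1 : ∀ s, 0 < s → s < R → |s * H' s - D s| ≤ a * H s)
    (h2 : ∀ s, 0 < s → s < R → D s ^ 2 ≤ H s * (s * D' s + C * D s)) (hpos : ∀ s ∈ Icc r (2 * r), 0 < H s) : 
    Real.log (H (2 * r) / H r) ≤ 2 ^ m * (2 * r * H' (2 * r) / H (2 * r)) + (2 ^ m + 1) * a ∧ 
    (2 * 2 ^ m)⁻¹ * (r * H' r / H r) - a ≤ Real.log (H (2 * r) / H r) := by
  have I0 : ∀ s ∈ Icc r (2 * r), 0 < s ∧ s < R := fun s hs => ⟨by linarith [hs.1], by linarith [hs.2]⟩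
  have dQ : ∀ s ∈ Icc r (2 * r), HasDerivAt (fun s => s ^ m * (D s / H s)) 
      (m * s ^ (m - 1) * (D s / H s) + s ^ m * ((D' s * H s - D s * H' s) / H s ^ 2)) s := by
    intro s hs
    exact (hasDerivAt_pow m s).fun_mul ((dD s (I0 s hs).1 (I0 s hs).2).fun_div (dH s (I0 s hs).1 (I0 s hs).2) (hpos s hs).ne')
  have mono : MonotoneOn (fun s => s ^ m * (D s / H s)) (Icc r (2 * r)) := by
    refine monotoneOn_of_deriv_nonneg (convex_Icc _ _) (fun s hs => (dQ s hs).continuousAt.continuousWithinAt) 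
      (fun s hs => (dQ s (interior_subset hs)).differentiableAt.differentiableWithinAt) ?_
    intro s hs
    have hs := interior_subset hs
    rw [(dQ s hs).deriv]
    obtain ⟨s0, sR⟩ := I0 s hs
    have hp := hpos s hs
    have e1 := h2 s s0 sR
    have e2 := (abs_le.1 (h1 s s0 sR)).2
    have e3 := hD0 s s0 sR
    have key : 0 ≤ m * (D s * H s) + s * (D' s * H s - D s * H' s) := by
      have k1 := mul_le_mul_of_nonneg_left e2 e3
      have k2 := mul_le_mul_of_nonneg_right hm (mul_nonneg e3 hp.le)
      nlinarith
    have : s * (m * s ^ (m - 1) * (D s / H s) + s ^ m * ((D' s * H s - D s * H' s) / H s ^ 2)) = 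
        s ^ m / H s ^ 2 * (m * (D s * H s) + s * (D' s * H s - D s * H' s)) := by
      rcases Nat.eq_zero_or_pos m with h | h
      · subst h; field_simp; simp
      · have : s ^ m = s ^ (m - 1) * s := by rw [← pow_succ]; congr 1; omega
        rw [this]; field_simp
    have : 0 ≤ s * (m * s ^ (m - 1) * (D s / H s) + s ^ m * ((D' s * H s - D s * H' s) / H s ^ 2)) := by
      rw [this]; positivity
    exact nonneg_of_mul_nonneg_right this s0
  obtain ⟨s, hs, hsl⟩ := exists_hasDerivAt_eq_slope (fun s => Real.log (H s)) (fun s => H' s / H s) (a := r) (b := 2 * r) (by linarith)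
    (fun s hs => ((dH s (I0 s hs).1 (I0 s hs).2).continuousAt.log (hpos s hs).ne').continuousWithinAt)
    (fun s hs => (dH s (I0 s (Ioo_subset_Icc_self hs)).1 (I0 s (Ioo_subset_Icc_self hs)).2).log (hpos s (Ioo_subset_Icc_self hs)).ne')
  have hs' := Ioo_subset_Icc_self hs
  obtain ⟨s0, sR⟩ := I0 s hs'
  have mr : r ∈ Icc r (2 * r) := ⟨le_rfl, by linarith⟩
  have m2 : 2 * r ∈ Icc r (2 * r) := ⟨by linarith, le_rfl⟩
  have hK : (0 : ℝ) < 2 ^ m := by positivity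
  have hlog : Real.log (H (2 * r) / H r) = r * (H' s / H s) := by
    rw [Real.log_div (hpos _ m2).ne' (hpos _ mr).ne', hsl]
    field_simp; ring
  have nQ : ∀ s ∈ Icc r (2 * r), |s * H' s / H s - D s / H s| ≤ a := by
    intro s hs
    rw [← sub_div, abs_div, abs_of_pos (hpos s hs), div_le_iff₀ (hpos s hs)]
    exact h1 s (I0 s hs).1 (I0 s hs).2
  have Q0 : ∀ s ∈ Icc r (2 * r), 0 ≤ D s / H s := fun s hs => div_nonneg (hD0 s (I0 s hs).1 (I0 s hs).2) (hpos s hs).le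
  have q1 : D s / H s ≤ 2 ^ m * (D (2 * r) / H (2 * r)) := by
    have := mono hs' m2 hs'.2
    simp only at this
    have h3 : (2 * r) ^ m ≤ 2 ^ m * s ^ m := by rw [← mul_pow]; exact pow_le_pow_left₀ (by positivity) (by linarith [hs.1]) m
    have h4 : s ^ m * (D s / H s) ≤ s ^ m * (2 ^ m * (D (2 * r) / H (2 * r))) := by
      refine this.trans ((mul_le_mul_of_nonneg_right h3 (Q0 _ m2)).trans (le_of_eq (by ring)))
    exact le_of_mul_le_mul_left h4 (by positivity)
  have q2 : D r / H r ≤ 2 ^ m * (D s / H s) := by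
    have := mono mr hs' hs'.1
    simp only at this
    have h3 : s ^ m ≤ 2 ^ m * r ^ m := by rw [← mul_pow]; exact pow_le_pow_left₀ (by positivity) (by linarith [hs.2]) m
    have h4 : r ^ m * (D r / H r) ≤ r ^ m * (2 ^ m * (D s / H s)) := by
      refine this.trans ((mul_le_mul_of_nonneg_right h3 (Q0 _ hs')).trans (le_of_eq (by ring)))
    exact le_of_mul_le_mul_left h4 (by positivity)
  have b1 := abs_le.1 (nQ s hs')
  have b2 := abs_le.1 (nQ r mr)
  have b3 := abs_le.1 (nQ _ m2)
  have hn : 0 ≤ H' s / H s := div_nonneg (hH' s s0 sR) (hpos s hs').le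
  have c1 : r * (H' s / H s) ≤ s * H' s / H s := by
    rw [mul_div_assoc]; exact mul_le_mul_of_nonneg_right hs.1.le hn
  have c2 : s * H' s / H s ≤ 2 * (r * (H' s / H s)) := by
    rw [mul_div_assoc, ← mul_assoc]; exact mul_le_mul_of_nonneg_right hs.2.le hn
  rw [hlog]
  constructor
  · have := mul_le_mul_of_nonneg_left b3.1 hK.le
    linarith
  · have h5 : r * H' r / H r ≤ 2 * 2 ^ m * (r * (H' s / H s) + a) := by
      have k1 : D s / H s ≤ 2 * (r * (H' s / H s)) + a := by linarith
      have k2 := mul_le_mul_of_nonneg_left k1 hK.le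
      have k3 : a ≤ 2 ^ m * a := le_mul_of_one_le_left ha (one_le_pow₀ (by norm_num))
      linarith
    rw [← inv_mul_le_iff₀ (by positivity)] at h5
    linarith

section Core
set_option linter.unusedSectionVars false
open Filter
variable {E : Type*} [NormedAddCommGroup E] [InnerProductSpace ℝ E] [FiniteDimensional ℝ E]
  [MeasurableSpace E] [BorelSpace E]
variable {T : E → E →L[ℝ] E} {v : E → ℝ} {p : E → E} {L Λ M R : ℝ}

namespace Core

lemma Dc_nonneg (h : Core T v p L Λ M R) {r : ℝ} (hr : 0 < r) (hrR : r < R) : 0 ≤ Dc T p r := by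
  refine setIntegral_nonneg measurableSet_ball fun y hy => ?_
  have hyr : ‖y‖ < r := by simpa using hy
  have := h.ell y (ball_subset_ball hrR.le hy) (p y)
  have h2 : 0 ≤ Λ⁻¹ * ‖p y‖ ^ 2 := by have := h.hΛ; positivity
  refine mul_nonneg ?_ (h2.trans this)
  nlinarith [norm_nonneg y]

lemma mu_nonneg (h : Core T v p L Λ M R) {y : E} (hy : y ∈ ball 0 R) : 0 ≤ mu T y := by
  have := (h.muinv_le hy).1
  exact inv_nonneg.1 this

lemma CS [Nontrivial E] (h : Core T v p L Λ M R) {r : ℝ} (hr : 0 < r) (hrR : r < R) (t : ℝ) : 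
    t * Dc T p r ≤ t ^ 2 * Hc T v r + ∫ y in ball (0 : E) r, (mu T y)⁻¹ * inner ℝ (T y (p y)) y ^ 2 := by
  have e : Dc T p r = ∫ y in ball (0 : E) r, 2 * (v y * inner ℝ (T y (p y)) y) := h.E1 hr hrR
  have c : ContinuousOn (fun y => 2 * (v y * inner ℝ (T y (p y)) y)) (ball 0 R) := 
    continuousOn_const.mul (h.contv.mul (h.contTp.inner continuousOn_id))
  rw [e, Hc, ← integral_const_mul, ← integral_const_mul, ← integral_add ((h.imv hrR).const_mul _) (h.iS hrR)]
  refine setIntegral_mono_on ((intB c hrR).const_mul _) (((h.imv hrR).const_mul _).add (h.iS hrR)) measurableSet_ball ?_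
  intro y hy
  have hy := ball_subset_ball hrR.le hy
  by_cases h0 : y = 0
  · subst h0; simp [mu]
  · have hm : 0 < mu T y := lt_of_lt_of_le (by have := h.hΛ; positivity) (h.mu_ge hy h0)
    have := mul_nonneg hm.le (sq_nonneg (t * v y - (mu T y)⁻¹ * inner ℝ (T y (p y)) y))
    have e2 : mu T y * (t * v y - (mu T y)⁻¹ * inner ℝ (T y (p y)) y) ^ 2 = 
      t ^ 2 * (mu T y * v y ^ 2) + (mu T y)⁻¹ * inner ℝ (T y (p y)) y ^ 2 - t * (2 * (v y * inner ℝ (T y (p y)) y)) := by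
      field_simp; ring
    linarith

lemma Hc_mono [Nontrivial E] (h : Core T v p L Λ M R) {r s : ℝ} (hrs : r ≤ s) (hs : s < R) : Hc T v r ≤ Hc T v s := by
  refine setIntegral_mono_set (h.imv hs) ?_ (ball_subset_ball hrs).eventuallyLE
  filter_upwards [ae_restrict_mem measurableSet_ball] with y hy
  exact mul_nonneg (h.mu_nonneg (ball_subset_ball hs.le hy)) (sq_nonneg _)

/-- the ODE constants -/
def ac (d L Λ M : ℝ) : ℝ := (d * (M + 1 + L)) * Λ

lemma main [Nontrivial E] (h : Core T v p L Λ M R) (m : ℕ) 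
    (hm : Crr (Module.finrank ℝ E) L Λ M + ac (Module.finrank ℝ E) L Λ M ≤ m)
    {r : ℝ} (hr : 0 < r) (hrR : 2 * r < R) (hp : 0 < Hc T v r) : 
    Real.log (Hc T v (2 * r) / Hc T v r) ≤ 2 ^ m * (2 * r * deriv (Hc T v) (2 * r) / Hc T v (2 * r)) + 
      (2 ^ m + 1) * ac (Module.finrank ℝ E) L Λ M ∧ 
    (2 * 2 ^ m)⁻¹ * (r * deriv (Hc T v) r / Hc T v r) - ac (Module.finrank ℝ E) L Λ M ≤ 
      Real.log (Hc T v (2 * r) / Hc T v r) := by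
  have hΛ := h.hΛ
  have hM := h.hM
  have hL := h.hL
  refine ode_core (H := Hc T v) (H' := deriv (Hc T v)) (D := Dc T p) 
    (D' := fun s => 2 * s * ∫ y in ball (0 : E) s, inner ℝ (T y (p y)) (p y)) (R := R) 
    (C := Crr (Module.finrank ℝ E) L Λ M) m hm ?_ hr hrR ?_ ?_ ?_ ?_ ?_ ?_ ?_
  · unfold ac; positivity
  · intro s s0 sR
    exact (h.Hc_deriv s0 sR).differentiableAt.hasDerivAt
  · intro s s0 sR
    exact deriv_weighted h.conte s0 sR
  · intro s s0 sR; exact h.Dc_nonneg s0 sR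
  · intro s s0 sR
    exact mono_deriv s0 sR (fun a b _ hab hb => h.Hc_mono hab.le hb) (h.Hc_deriv s0 sR).differentiableAt.hasDerivAt
  · intro s s0 sR
    exact h.step2 s0 sR
  · intro s s0 sR
    have h3 := h.step3 s0 sR
    have hD := h.Dc_nonneg s0 sR
    set S := ∫ y in ball (0 : E) s, (mu T y)⁻¹ * inner ℝ (T y (p y)) y ^ 2
    have k := h.CS s0 sR
    have H0 : 0 ≤ Hc T v s := setIntegral_nonneg measurableSet_ball fun y hy => 
      mul_nonneg (h.mu_nonneg (ball_subset_ball sR.le hy)) (sq_nonneg _)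
    have key : Dc T p s ^ 2 ≤ Hc T v s * (4 * S) := by
      rcases H0.eq_or_lt with h0 | h0
      · have : Dc T p s ≤ 0 := by
          by_contra hh
          push Not at hh
          have := k ((S + 1) / Dc T p s)
          rw [← h0, div_mul_cancel₀ _ hh.ne'] at this
          linarith
        have : Dc T p s = 0 := le_antisymm this hD
        rw [this, ← h0]; simp
      · have := k (Dc T p s / (2 * Hc T v s))
        have e : Dc T p s / (2 * Hc T v s) * Dc T p s - (Dc T p s / (2 * Hc T v s)) ^ 2 * Hc T v s = 
          Dc T p s ^ 2 / (4 * Hc T v s) := by field_simp; ring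
        have : Dc T p s ^ 2 / (4 * Hc T v s) ≤ S := by linarith
        rw [div_le_iff₀ (by positivity)] at this
        linarith
    refine key.trans (mul_le_mul_of_nonneg_left ?_ H0)
    calc 4 * S ≤ _ := h3
      _ ≤ _ := by linarith
  · intro s hs
    exact hp.trans_le (h.Hc_mono hs.1 (by linarith [hs.2]))

end Core
end Core


section Fin9
open Filter

lemma aForm_bd {k : ℕ} (N : Matrix (Fin k) (Fin k) ℝ) {c : ℝ} (hN : ∀ i j, |N i j| ≤ c) (a b : Euc k) :
    |aForm N a b| ≤ (k : ℝ) ^ 2 * c * ‖a‖ * ‖b‖ := by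
  unfold aForm
  refine (Finset.abs_sum_le_sum_abs _ _).trans ?_
  refine (Finset.sum_le_sum (g := fun _ => (k : ℝ) * (c * ‖a‖ * ‖b‖)) fun i _ => ?_).trans (le_of_eq (by simp; ring))
  refine (Finset.abs_sum_le_sum_abs _ _).trans ?_
  refine (Finset.sum_le_sum (g := fun _ => (c * ‖a‖ * ‖b‖)) fun j _ => ?_).trans (le_of_eq (by simp))
  rw [abs_mul, abs_mul]
  have h1 : |a j| ≤ ‖a‖ := PiLp.norm_apply_le a j
  have h2 : |b i| ≤ ‖b‖ := PiLp.norm_apply_le b i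
  have hc : 0 ≤ c := (abs_nonneg _).trans (hN i j)
  have := hN i j
  gcongr

def tcl {k : ℕ} (N : Matrix (Fin k) (Fin k) ℝ) : Euc k →L[ℝ] Euc k := Matrix.toEuclideanCLM (𝕜 := ℝ) N

lemma tcl_inner {k : ℕ} (N : Matrix (Fin k) (Fin k) ℝ) (a b : Euc k) : inner ℝ (tcl N a) b = aForm N a b := by
  rw [PiLp.inner_apply]
  unfold aForm tcl
  refine Finset.sum_congr rfl fun i _ => ?_
  rw [Matrix.ofLp_toEuclideanCLM, Matrix.mulVec, dotProduct, real_inner_comm, real_inner_eq_re_inner ℝ]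
  simp only [RCLike.re_to_real, RCLike.inner_apply, conj_trivial]
  rw [Finset.sum_mul]

lemma tcl_sub {k : ℕ} (N N' : Matrix (Fin k) (Fin k) ℝ) : tcl N - tcl N' = tcl (N - N') := by
  unfold tcl; rw [map_sub]

lemma tcl_norm {k : ℕ} (N : Matrix (Fin k) (Fin k) ℝ) {c : ℝ} (hc : 0 ≤ c) (hN : ∀ i j, |N i j| ≤ c) : 
    ‖tcl N‖ ≤ (k : ℝ) ^ 2 * c := by
  refine ContinuousLinearMap.opNorm_le_bound _ (by positivity) fun a => ?_
  have h1 := (le_abs_self _).trans (aForm_bd N hN a (tcl N a))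
  rw [← tcl_inner, real_inner_self_eq_norm_sq] at h1
  rcases (norm_nonneg (tcl N a)).eq_or_lt with h | h
  · rw [← h]; positivity
  · rw [pow_two] at h1
    exact le_of_mul_le_mul_right h1 h

lemma aForm_symm {k : ℕ} {N : Matrix (Fin k) (Fin k) ℝ} (hN : N.IsSymm) (a b : Fin k → ℝ) : aForm N a b = aForm N b a := by
  unfold aForm
  rw [Finset.sum_comm]
  refine Finset.sum_congr rfl fun i _ => Finset.sum_congr rfl fun j _ => ?_
  rw [hN.apply i j]; ring

lemma trans_int {k : ℕ} (x : Euc k) (s : ℝ) (f : Euc k → ℝ) : ∫ z in ball x s, f z = ∫ y in ball (0 : Euc k) s, f (x + y) := by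
  have h := (measurePreserving_add_left (volume : Measure (Euc k)) x).setIntegral_preimage_emb 
    (MeasurableEquiv.addLeft x).measurableEmbedding f (ball x s)
  rw [← h]
  congr 2
  ext y
  simp [mem_ball, dist_eq_norm]

def gv {k : ℕ} (v : Euc k → ℝ) (z : Euc k) : Euc k := WithLp.toLp 2 (gradVec v z)

lemma gv_inner {k : ℕ} (v : Euc k → ℝ) (z w : Euc k) : inner ℝ (gv v z) w = fderiv ℝ v z w := by
  have h : w = ∑ i, w i • EuclideanSpace.single i (1 : ℝ) := by
    ext j; simp [Finset.sum_apply, Pi.single_apply]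
  conv_rhs => rw [h, map_sum]
  rw [PiLp.inner_apply]
  refine Finset.sum_congr rfl fun i _ => ?_
  simp [gv, gradVec]

lemma exists_core {k : ℕ} (L : ℝ≥0) (Λ : ℝ) (hk : 2 ≤ k) (hΛ : 1 ≤ Λ) {A : Euc k → Matrix (Fin k) (Fin k) ℝ} 
    (hs : ∀ x ∈ ball (0 : Euc k) 1, (A x).IsSymm) (hl : LipEntries A L (ball 0 1)) (he : UnifElliptic A Λ (ball 0 1))
    (h1 : A 0 = 1) {v : Euc k → ℝ} (hv : ContDiffOn ℝ 1 v (ball 0 1)) (hw : IsWeakSol A v (ball 0 1))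
    {x : Euc k} (hx : x ∈ ball (0 : Euc k) (1 / 2)) : 
    ∃ T : Euc k → Euc k →L[ℝ] Euc k, (∀ y ∈ ball (0 : Euc k) (1 / 2), T y = tcl (A (x + y))) ∧ 
      Core T (fun y => v (x + y)) (fun y => gv v (x + y)) ((k : ℝ) ^ 2 * L) Λ ((k : ℝ) ^ 2 * (1 + L)) (1 / 2) := by
  have mem : ∀ y ∈ ball (0 : Euc k) (1 / 2), x + y ∈ ball (0 : Euc k) 1 := fun y hy => by
    rw [mem_ball_zero_iff] at *
    linarith [norm_add_le x y]
  have hk1 : (1 : ℝ) ≤ (k : ℝ) ^ 2 := one_le_pow₀ (by exact_mod_cast (by omega : 1 ≤ k))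
  have := fun i j => (hl i j).extend_real
  choose g hg hgA using this
  have hT : ∀ y ∈ ball (0 : Euc k) (1 / 2), tcl (Matrix.of fun i j => g i j (x + y)) = tcl (A (x + y)) := by
    intro y hy
    congr 1
    ext i j
    exact (hgA i j (mem y hy)).symm
  refine ⟨fun y => tcl (Matrix.of fun i j => g i j (x + y)), hT, ?_⟩
  refine ⟨by positivity, hΛ, ?_, by norm_num, by norm_num, ?_, ?_, ?_, ?_, ?_, ?_, ?_⟩
  · have : (0 : ℝ) ≤ L := L.2
    nlinarith
  · intro y z
    rw [tcl_sub, mul_assoc]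
    refine tcl_norm _ (by positivity) fun i j => ?_
    have := (hg i j).dist_le_mul (x + y) (x + z)
    rw [Real.dist_eq, dist_eq_norm] at this
    simpa using this
  · intro y hy a b
    rw [hT y hy, tcl_inner, real_inner_comm, tcl_inner]
    exact aForm_symm (hs _ (mem y hy)) _ _
  · intro y hy a
    rw [hT y hy, tcl_inner, EuclideanSpace.real_norm_sq_eq]
    exact (he _ (mem y hy) _).1
  · intro y hy
    rw [hT y hy]
    refine tcl_norm _ (by positivity) fun i j => ?_
    have h2 := (hl i j).dist_le_mul (x + y) (mem y hy) 0 (mem_ball_self one_pos)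
    rw [Real.dist_eq, dist_zero_right] at h2
    simp only [h1] at h2
    have h3 : ‖x + y‖ ≤ 1 := (mem_ball_zero_iff.1 (mem y hy)).le
    have h4 : |(1 : Matrix (Fin k) (Fin k) ℝ) i j| ≤ 1 := by
      rw [Matrix.one_apply]; split_ifs <;> simp
    have h5 : (L : ℝ) * ‖x + y‖ ≤ L := mul_le_of_le_one_right L.2 h3
    have := abs_add_le (A (x + y) i j - (1 : Matrix (Fin k) (Fin k) ℝ) i j) ((1 : Matrix (Fin k) (Fin k) ℝ) i j)
    rw [sub_add_cancel] at this
    linarith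
  · intro y hy
    have d1 : HasFDerivAt v (fderiv ℝ v (x + y)) (x + y) := 
      ((hv.contDiffAt (isOpen_ball.mem_nhds (mem y hy))).differentiableAt (by simp)).hasFDerivAt
    have d2 : HasFDerivAt (fun y => v (x + y)) (fderiv ℝ v (x + y)) y := by
      have := HasFDerivAt.comp (f := fun y => x + y) y d1 ((hasFDerivAt_id y).const_add x)
      rw [ContinuousLinearMap.comp_id] at this
      exact this
    refine d2.congr_fderiv ?_
    ext w
    rw [innerSL_apply_apply, gv_inner]
  · have c1 : ContinuousOn (fderiv ℝ v) (ball 0 1) := hv.continuousOn_fderiv_of_isOpen isOpen_ball le_rfl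
    have c2 : ContinuousOn (fun y => fderiv ℝ v (x + y)) (ball 0 (1 / 2)) := c1.comp (by fun_prop) mem
    refine (PiLp.continuous_toLp 2 _).comp_continuousOn ?_
    refine continuousOn_pi.2 fun i => ?_
    exact c2.clm_apply continuousOn_const
  · intro ψ hψ hψc hψs
    have key := hw (fun z => ψ (z - x)) (by fun_prop) (hψc.comp_homeomorph (Homeomorph.subRight x)) ?_
    · have hout : ∀ z, z - x ∉ ball (0 : Euc k) (1 / 2) → gradVec (fun z => ψ (z - x)) z = 0 := by
        intro z hz
        have : fderiv ℝ (fun z => ψ (z - x)) z = 0 := by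
          rw [fderiv_comp_sub]
          exact image_eq_zero_of_notMem_tsupport fun hh => hz (hψs (tsupport_fderiv_subset ℝ hh))
        ext i; simp [gradVec, this]
      have hsub : ball x (1 / 2) ⊆ ball (0 : Euc k) 1 := by
        intro z hz
        have := mem (z - x) (by rwa [mem_ball_zero_iff, ← dist_eq_norm])
        simpa using this
      rw [setIntegral_eq_of_subset_of_forall_sdiff_eq_zero measurableSet_ball hsub, trans_int] at key
      · rw [← key]
        refine setIntegral_congr_fun measurableSet_ball fun y hy => ?_
        show fderiv ℝ ψ y (tcl (Matrix.of fun i j => g i j (x + y)) (gv v (x + y))) = _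
        rw [hT y hy, ← gv_inner, real_inner_comm, tcl_inner]
        have : gradVec (fun z => ψ (z - x)) (x + y) = gradVec ψ y := by
          ext i; simp only [gradVec]; rw [fderiv_comp_sub]; simp
        rw [this]; rfl
      · intro z hz
        rw [hout z (by rw [mem_ball_zero_iff, ← dist_eq_norm]; exact hz.2)]
        simp [aForm]
    · intro z hz
      have : z - x ∈ tsupport ψ := by
        have := tsupport_comp_subset_preimage ψ (f := fun z : Euc k => z - x) (by fun_prop) hz
        exact this
      have := mem _ (hψs this)
      simpa using this

lemma alpha_cont {k : ℕ} {L : ℝ≥0} {A : Euc k → Matrix (Fin k) (Fin k) ℝ} 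
    (hl : LipEntries A L (ball 0 1)) (h1 : A 0 = 1) : ContinuousOn (alphaFn A) (ball 0 1) := by
  have cA : ContinuousOn (fun z : Euc k => aForm (A z) (fun i => z i) (fun i => z i)) (ball 0 1) := by
    unfold aForm
    refine continuousOn_finsetSum _ fun i _ => continuousOn_finsetSum _ fun j _ => ?_
    exact ((hl i j).continuousOn.mul (by fun_prop)).mul (by fun_prop)
  intro z hz
  by_cases h0 : z = 0
  · subst h0
    refine ContinuousAt.continuousWithinAt ?_
    have a0 : alphaFn A 0 = 1 := by simp [alphaFn]
    rw [ContinuousAt, a0, tendsto_iff_norm_sub_tendsto_zero]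
    have lim : Tendsto (fun z : Euc k => (k : ℝ) ^ 2 * L * ‖z‖) (𝓝 0) (𝓝 0) := by
      have : Continuous (fun z : Euc k => (k : ℝ) ^ 2 * L * ‖z‖) := by fun_prop
      simpa using this.tendsto 0
    refine squeeze_zero' (Eventually.of_forall fun _ => norm_nonneg _) ?_ lim
    filter_upwards [isOpen_ball.mem_nhds (mem_ball_self (x := (0 : Euc k)) one_pos)] with z hz
    by_cases hz0 : z = 0
    · subst hz0; simp [a0]
    have e : aForm (A z) (fun i => z i) (fun i => z i) - ‖z‖ ^ 2 = aForm (A z - 1) z z := by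
      rw [EuclideanSpace.real_norm_sq_eq]
      simp only [aForm, Matrix.sub_apply, sub_mul, Finset.sum_sub_distrib]
      congr 1
      refine Finset.sum_congr rfl fun i _ => ?_
      simp [Matrix.one_apply, pow_two]
    have b := aForm_bd (A z - 1) (c := L * ‖z‖) (fun i j => by
      have h2 := (hl i j).dist_le_mul z hz 0 (mem_ball_self one_pos)
      rw [Real.dist_eq, dist_zero_right] at h2
      rw [h1] at h2
      exact h2) z z
    have hn : 0 < ‖z‖ := norm_pos_iff.2 hz0
    have e2 : alphaFn A z - 1 = aForm (A z - 1) z z / ‖z‖ ^ 2 := by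
      rw [alphaFn, if_neg hz0, ← e]; field_simp
    rw [e2, Real.norm_eq_abs, abs_div, abs_of_nonneg (sq_nonneg ‖z‖), div_le_iff₀ (by positivity)]
    refine b.trans (le_of_eq (by ring))
  · have : ContinuousAt (fun z : Euc k => aForm (A z) (fun i => z i) (fun i => z i) / ‖z‖ ^ 2) z := 
      ((cA.continuousAt (isOpen_ball.mem_nhds hz)).div (by fun_prop) (by simpa using h0))
    refine (this.congr ?_).continuousWithinAt
    filter_upwards [isOpen_compl_singleton.mem_nhds (show z ∈ ({0} : Set (Euc k))ᶜ from h0)] with w hw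
    have hw : w ≠ 0 := hw
    rw [alphaFn, if_neg hw]

lemma aForm_q {k : ℕ} {Λ : ℝ} {A : Euc k → Matrix (Fin k) (Fin k) ℝ} (he : UnifElliptic A Λ (ball 0 1))
    {z : Euc k} (hz : z ∈ ball (0 : Euc k) 1) {y : Euc k} (hy : y ≠ 0) : 
    Λ⁻¹ ≤ aForm (A z) y y / ‖y‖ ^ 2 ∧ aForm (A z) y y / ‖y‖ ^ 2 ≤ Λ := by
  have h := he z hz y
  rw [← EuclideanSpace.real_norm_sq_eq] at h
  have hn : 0 < ‖y‖ := norm_pos_iff.2 hy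
  rw [le_div_iff₀ (by positivity), div_le_iff₀ (by positivity)]
  exact h

lemma cmp9 {E : Type*} [NormedAddCommGroup E] [InnerProductSpace ℝ E] [FiniteDimensional ℝ E]
    [MeasurableSpace E] [BorelSpace E] [Nontrivial E] {f g : E → ℝ} {R q : ℝ} 
    (hf : ∀ s < R, IntegrableOn f (ball 0 s)) (hg : ∀ s < R, IntegrableOn g (ball 0 s)) 
    (hfg : ∀ y ∈ ball (0 : E) R, y ≠ 0 → f y ≤ q * g y) {r f' g' : ℝ} (hr : 0 < r) (hrR : r < R)
    (df : HasDerivAt (fun s => ∫ y in ball (0 : E) s, f y) f' r) (dg : HasDerivAt (fun s => ∫ y in ball (0 : E) s, g y) g' r) : 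
    (∫ y in ball (0 : E) r, f y) ≤ q * (∫ y in ball (0 : E) r, g y) ∧ f' ≤ q * g' := by
  have hne : ∀ᵐ y : E, y ≠ 0 := by rw [ae_iff]; simp
  have e : ∀ s < R, ∫ y in ball (0 : E) s, (q * g y - f y) = q * (∫ y in ball (0 : E) s, g y) - ∫ y in ball (0 : E) s, f y := by
    intro s hs
    rw [integral_sub ((hg s hs).const_mul q) (hf s hs), integral_const_mul]
  have nn : ∀ s < R, 0 ≤ᵐ[volume.restrict (ball (0 : E) s)] fun y => q * g y - f y := by
    intro s hs
    filter_upwards [ae_restrict_mem measurableSet_ball, ae_restrict_of_ae hne] with y hy hy0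
    simpa using hfg y (ball_subset_ball hs.le hy) hy0
  constructor
  · have := integral_nonneg_of_ae (nn r hrR)
    rw [e r hrR] at this
    linarith
  · have := mono_deriv hr hrR (f := fun s => q * (∫ y in ball (0 : E) s, g y) - ∫ y in ball (0 : E) s, f y) ?_ ((dg.const_mul q).fun_sub df)
    · linarith
    · intro a b ha hab hb
      rw [← e a (hab.trans hb), ← e b hb]
      exact setIntegral_mono_set (((hg b hb).const_mul q).sub (hf b hb)) (nn b hb) (ball_subset_ball hab.le).eventuallyLE

lemma final9 {H H' G G' Q Q' P P' q K a : ℝ} (hq : 1 ≤ q) (hK : 1 ≤ K) (ha : 0 ≤ a) {r : ℝ} (hr : 0 < r)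
    (hH : 0 < H) (hQ : 0 < Q) (hQ' : 0 ≤ Q') (hH' : 0 ≤ H')
    (a1 : H ≤ q * G) (a2 : G ≤ q * H) (b1 : H' ≤ q * G') (b2 : G' ≤ q * H')
    (c1 : Q ≤ q * P) (c2 : P ≤ q * Q) (d1 : Q' ≤ q * P') (d2 : P' ≤ q * Q') 
    (u : Real.log (P / G) ≤ K * (2 * r * P' / P) + (K + 1) * a) (l : (2 * K)⁻¹ * (r * G' / G) - a ≤ Real.log (P / G)) : 
    (2 * K * q ^ 2)⁻¹ * (r * H' / H) - ((K + 1) * a + Real.log (q ^ 2) + 1) ≤ Real.log (Q / H) ∧ 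
    Real.log (Q / H) ≤ (2 * K * q ^ 2) * (2 * r * Q' / Q) + ((K + 1) * a + Real.log (q ^ 2) + 1) := by
  have q0 : 0 < q := by linarith
  have K0 : 0 < K := by linarith
  have hG : 0 < G := pos_of_mul_pos_right (hH.trans_le a1) q0.le
  have hP : 0 < P := pos_of_mul_pos_right (hQ.trans_le c1) q0.le
  have G0 : 0 ≤ G' := nonneg_of_mul_nonneg_right (hH'.trans b1) q0
  have hlq : 0 ≤ Real.log (q ^ 2) := Real.log_nonneg (one_le_pow₀ hq)
  have e1 : Real.log (Q / H) ≤ Real.log (q ^ 2) + Real.log (P / G) := by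
    rw [← Real.log_mul (by positivity) (by positivity)]
    refine Real.log_le_log (by positivity) ?_
    rw [div_le_iff₀ hH, ← mul_div_assoc, div_mul_eq_mul_div, le_div_iff₀ hG]
    calc Q * G ≤ (q * P) * (q * H) := by gcongr
      _ = _ := by ring
  have e2 : Real.log (P / G) ≤ Real.log (q ^ 2) + Real.log (Q / H) := by
    rw [← Real.log_mul (by positivity) (by positivity)]
    refine Real.log_le_log (by positivity) ?_
    rw [div_le_iff₀ hG, ← mul_div_assoc, div_mul_eq_mul_div, le_div_iff₀ hH]
    calc P * H ≤ (q * Q) * (q * G) := by gcongr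
      _ = _ := by ring
  have e3 : r * H' / H ≤ q ^ 2 * (r * G' / G) := by
    rw [div_le_iff₀ hH, ← mul_div_assoc, div_mul_eq_mul_div, le_div_iff₀ hG]
    calc r * H' * G ≤ r * (q * G') * (q * H) := by gcongr
      _ = _ := by ring
  have e4 : 2 * r * P' / P ≤ q ^ 2 * (2 * r * Q' / Q) := by
    rw [div_le_iff₀ hP, ← mul_div_assoc, div_mul_eq_mul_div, le_div_iff₀ hQ]
    calc 2 * r * P' * Q ≤ 2 * r * (q * Q') * (q * P) := by gcongr
      _ = _ := by ring
  have hN : 0 ≤ 2 * r * Q' / Q := by positivity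
  constructor
  · have : (2 * K * q ^ 2)⁻¹ * (r * H' / H) ≤ (2 * K)⁻¹ * (r * G' / G) := by
      rw [inv_mul_le_iff₀ (by positivity)]
      refine e3.trans (le_of_eq ?_)
      field_simp
    have : 0 ≤ K * a := by positivity
    linarith
  · have k1 := mul_le_mul_of_nonneg_left e4 K0.le
    have k2 : 0 ≤ K * (q ^ 2 * (2 * r * Q' / Q)) := by positivity
    linarith

end Fin9

/-- Let `v ∈ W^{1,2}_loc(B(0,1))` be a (not identically zero) weak solution
of `div(A∇v) = 0` in `B = B(0,1) ⊆ ℝᵏ`, where `A` is symmetric, uniformly elliptic with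
constant `Λ`, has `L`-Lipschitz entries, and `A(0) = Id`. Then there are constants
`ρ₀, C₁, C₂ > 0`, depending only on `k`, `L` and `Λ`, such that for every `x ∈ B(0,1/2)`
and every `r` with `0 < 4r < ρ₀`, one has
`C₁⁻¹ N_v(x,r) − C₂ ≤ 𝒩_v(x,r) ≤ C₁ N_v(x,2r) + C₂`, where `N_v` is the frequency
function and `𝒩_v` the doubling index. -/
theorem statement_3 (k : ℕ) (hk : 2 ≤ k) (L : ℝ≥0) (Λ : ℝ) (hΛ : 1 ≤ Λ) :
    ∃ ρ₀ > (0 : ℝ), ∃ C₁ > (0 : ℝ), ∃ C₂ > (0 : ℝ),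
      ∀ A : Euc k → Matrix (Fin k) (Fin k) ℝ,
        (∀ x ∈ ball (0 : Euc k) 1, (A x).IsSymm) →
        LipEntries A L (ball 0 1) →
        UnifElliptic A Λ (ball 0 1) →
        A 0 = 1 →
        ∀ v : Euc k → ℝ,
          ContDiffOn ℝ 1 v (ball 0 1) →
          IsWeakSol A v (ball 0 1) →
          (∃ x ∈ ball (0 : Euc k) 1, v x ≠ 0) →
          ∀ x ∈ ball (0 : Euc k) (1 / 2), ∀ r : ℝ,
            0 < r → 4 * r < ρ₀ →
            C₁⁻¹ * freqN A v x r - C₂ ≤ doubN A v x r ∧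
            doubN A v x r ≤ C₁ * freqN A v x (2 * r) + C₂ := by
  have hk0 : (0 : ℝ) < k := by exact_mod_cast (by omega : 0 < k)
  have hL0 : (0 : ℝ) ≤ L := L.2
  set Lc : ℝ := (k : ℝ) ^ 2 * L with hLc
  set M : ℝ := (k : ℝ) ^ 2 * (1 + L) with hM
  set m : ℕ := ⌈Core.Crr (k : ℝ) Lc Λ M + Core.ac (k : ℝ) Lc Λ M⌉₊ with hm
  set a : ℝ := Core.ac (k : ℝ) Lc Λ M with ha
  have ha0 : 0 ≤ a := by rw [ha, Core.ac, hM, hLc]; positivity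
  have hK : (1 : ℝ) ≤ 2 ^ m := one_le_pow₀ (by norm_num)
  have hq : 1 ≤ Λ ^ 2 := one_le_pow₀ hΛ
  have hlq : 0 ≤ Real.log ((Λ ^ 2) ^ 2) := Real.log_nonneg (one_le_pow₀ hq)
  refine ⟨1, one_pos, 2 * 2 ^ m * (Λ ^ 2) ^ 2, by positivity, (2 ^ m + 1) * a + Real.log ((Λ ^ 2) ^ 2) + 1, by positivity, ?_⟩
  intro A hs hl he h1 v hv hw _ x hx r hr hr4
  haveI : Nontrivial (Euc k) := by
    have : Nonempty (Fin k) := ⟨⟨0, by omega⟩⟩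
    infer_instance
  obtain ⟨T, hT, h⟩ := exists_core L Λ hk hΛ hs hl he h1 hv hw hx
  have mem : ∀ y ∈ ball (0 : Euc k) (1 / 2), x + y ∈ ball (0 : Euc k) 1 := fun y hy => by
    rw [mem_ball_zero_iff] at *
    linarith [norm_add_le x y]
  have Λ0 : 0 < Λ := by linarith
  have hi0 : 0 < Λ⁻¹ := by positivity
  set f : Euc k → ℝ := fun y => alphaFn A (x + y) * v (x + y) ^ 2 with hf
  set w : Euc k → ℝ := fun y => v (x + y) with hwd
  have hHf : Hfun A v x = fun s => ∫ y in ball (0 : Euc k) s, f y := by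
    ext s; exact trans_int x s _
  have cf : ContinuousOn f (ball 0 (1 / 2)) := by
    refine ContinuousOn.mul ?_ (h.contv.pow 2)
    exact (alpha_cont hl h1).comp (by fun_prop) mem
  have jf : ∀ s < 1 / 2, IntegrableOn f (ball 0 s) := fun s hs => intB cf hs
  have jg : ∀ s < 1 / 2, IntegrableOn (fun y => mu T y * w y ^ 2) (ball 0 s) := fun s hs => h.imv hs
  have al : ∀ y ∈ ball (0 : Euc k) (1 / 2), Λ⁻¹ ≤ alphaFn A (x + y) ∧ alphaFn A (x + y) ≤ Λ := by
    intro y hy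
    unfold alphaFn
    split_ifs with h0
    · exact ⟨inv_le_one_of_one_le₀ hΛ, hΛ⟩
    · exact aForm_q he (mem y hy) h0
  have ml : ∀ y ∈ ball (0 : Euc k) (1 / 2), y ≠ 0 → Λ⁻¹ ≤ mu T y ∧ mu T y ≤ Λ := by
    intro y hy h0
    rw [mu, hT y hy, tcl_inner]
    exact aForm_q he (mem y hy) h0
  have ee : Λ = Λ ^ 2 * Λ⁻¹ := by field_simp
  have fg : ∀ y ∈ ball (0 : Euc k) (1 / 2), y ≠ 0 → f y ≤ Λ ^ 2 * (mu T y * w y ^ 2) := by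
    intro y hy h0
    have : alphaFn A (x + y) ≤ Λ ^ 2 * mu T y := by
      refine (al y hy).2.trans ?_
      conv_lhs => rw [ee]
      exact mul_le_mul_of_nonneg_left (ml y hy h0).1 (by positivity)
    have := mul_le_mul_of_nonneg_right this (sq_nonneg (w y))
    rw [← mul_assoc]; exact this
  have gf : ∀ y ∈ ball (0 : Euc k) (1 / 2), y ≠ 0 → mu T y * w y ^ 2 ≤ Λ ^ 2 * f y := by
    intro y hy h0
    have : mu T y ≤ Λ ^ 2 * alphaFn A (x + y) := by
      refine (ml y hy h0).2.trans ?_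
      conv_lhs => rw [ee]
      exact mul_le_mul_of_nonneg_left (al y hy).1 (by positivity)
    have := mul_le_mul_of_nonneg_right this (sq_nonneg (w y))
    rw [hf]; simp only; rw [← mul_assoc]; exact this
  have f0 : ∀ y ∈ ball (0 : Euc k) (1 / 2), 0 ≤ f y := fun y hy => 
    mul_nonneg (hi0.le.trans (al y hy).1) (sq_nonneg _)
  have df : ∀ s, 0 < s → s < 1 / 2 → HasDerivAt (Hfun A v x) (deriv (Hfun A v x) s) s := by
    intro s s0 sR
    rw [hHf]
    exact (polar_deriv_base (cf.mono sdiff_subset) jf s0 sR).differentiableAt.hasDerivAt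
  have dg : ∀ s, 0 < s → s < 1 / 2 → HasDerivAt (Core.Hc T w) (deriv (Core.Hc T w) s) s := fun s s0 sR => 
    (h.Hc_deriv s0 sR).differentiableAt.hasDerivAt
  have Hmono : ∀ s t, s ≤ t → t < 1 / 2 → Hfun A v x s ≤ Hfun A v x t := by
    intro s t hst ht
    rw [hHf]
    refine setIntegral_mono_set (jf t ht) ?_ (ball_subset_ball hst).eventuallyLE
    filter_upwards [ae_restrict_mem measurableSet_ball] with y hy
    exact f0 y (ball_subset_ball ht.le hy)
  have H0 : ∀ s < 1 / 2, 0 ≤ Hfun A v x s := by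
    intro s hs
    rw [hHf]
    exact setIntegral_nonneg measurableSet_ball fun y hy => f0 y (ball_subset_ball hs.le hy)
  have Hd0 : ∀ s, 0 < s → s < 1 / 2 → 0 ≤ deriv (Hfun A v x) s := fun s s0 sR => 
    mono_deriv s0 sR (fun a b _ hab hb => Hmono a b hab.le hb) (df s s0 sR)
  have r1 : r < 1 / 2 := by linarith
  have r2 : 2 * r < 1 / 2 := by linarith
  have r20 : 0 < 2 * r := by linarith
  have cA := fun s (s0 : 0 < s) (sR : s < 1 / 2) => cmp9 jf jg fg s0 sR (by rw [← hHf]; exact df s s0 sR) (dg s s0 sR)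
  have cB := fun s (s0 : 0 < s) (sR : s < 1 / 2) => cmp9 jg jf gf s0 sR (dg s s0 sR) (by rw [← hHf]; exact df s s0 sR)
  have cA1 : ∀ s, 0 < s → s < 1 / 2 → Hfun A v x s ≤ Λ ^ 2 * Core.Hc T w s := fun s s0 sR => by
    rw [hHf]; exact (cA s s0 sR).1
  have cB1 : ∀ s, 0 < s → s < 1 / 2 → Core.Hc T w s ≤ Λ ^ 2 * Hfun A v x s := fun s s0 sR => by
    rw [hHf]; exact (cB s s0 sR).1
  unfold freqN doubN
  rcases (H0 r r1).eq_or_lt with hz | hz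
  · rw [← hz]
    have : 0 ≤ 2 * r * deriv (Hfun A v x) (2 * r) / Hfun A v x (2 * r) := 
      div_nonneg (mul_nonneg r20.le (Hd0 _ r20 r2)) (H0 _ r2)
    have p1 : 0 ≤ 2 * 2 ^ m * (Λ ^ 2) ^ 2 * (2 * r * deriv (Hfun A v x) (2 * r) / Hfun A v x (2 * r)) := by positivity
    have p2 : 0 ≤ (2 ^ m + 1) * a + Real.log ((Λ ^ 2) ^ 2) + 1 := by positivity
    simp only [div_zero, mul_zero, Real.log_zero]
    constructor <;> linarith
  · have hp : 0 < Core.Hc T w r := pos_of_mul_pos_right (hz.trans_le (cA1 r hr r1)) (by positivity)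
    have fr : (Module.finrank ℝ (Euc k) : ℝ) = k := by simp
    have mn := h.main m (by rw [fr]; exact Nat.le_ceil _) hr r2 hp
    rw [fr] at mn
    exact final9 hq hK ha0 hr hz (hz.trans_le (Hmono r (2 * r) (by linarith) r2)) (Hd0 _ r20 r2) (Hd0 r hr r1) 
      (cA1 r hr r1) (cB1 r hr r1) (cA r hr r1).2 (cB r hr r1).2 
      (cA1 _ r20 r2) (cB1 _ r20 r2) (cA _ r20 r2).2 (cB _ r20 r2).2 mn.1 mn.2
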